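/- arXiv:1002.1605 — 5 statements merged into one kernel-verified Lean document; each statement's English description precedes it below -/
import Mathlib

section
/- Let n ≥ 2 be an integer and let M be a positive integer. Then there exist C > 0 and a positive integer k (depending only on n and M) such that for every finite field K of characteristic > n, for every maximal torus T of SL_n over K̄, for every nontrivial character α of T whose exponents (m₁,…,m_n) satisfy |m_i| ≤ M for all i, and for every set A ⊆ SL_n(K) generating SL_n(K), we have |A ∩ T'(K)| ≤ C·|A_k|^{1/(n+2)}, where T' = ker α ⊆ T and T'(K) = {x ∈ SL_n(K) : x ∈ T' when viewed in SL_n(K̄)}. -/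
open Pointwise

/-- `A_r = (A ∪ A⁻¹ ∪ {1})^r`. -/
def prodSet {G : Type*} [Group G] (A : Set G) (r : ℕ) : Set G :=
  (A ∪ A⁻¹ ∪ {1}) ^ r

/-- The maximal torus `γ D γ⁻¹` of `SL_n(L)` determined by `γ ∈ GL_n(L)`, where `D` is
the set of diagonal matrices in `SL_n(L)`. -/
def torusOf (n : ℕ) (L : Type*) [Field L] (γ : (Matrix (Fin n) (Fin n) L)ˣ) :
    Set (Matrix.SpecialLinearGroup (Fin n) L) :=
  {x | ∃ d : Matrix (Fin n) (Fin n) L, d.IsDiag ∧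
    (x : Matrix (Fin n) (Fin n) L) = (γ : Matrix (Fin n) (Fin n) L) * d *
      ((γ⁻¹ : (Matrix (Fin n) (Fin n) L)ˣ) : Matrix (Fin n) (Fin n) L)}

/-- The value at `x` of the character of the torus `γ D γ⁻¹` with exponents
`m = (m₁, …, m_n)`: writing `x = γ·diag(x₁,…,x_n)·γ⁻¹`, it is `x₁^{m₁}⋯x_n^{m_n}`,
i.e. `∏ j (γ⁻¹ x γ)_{jj}^{m_j}`. -/
def charOf (n : ℕ) (L : Type*) [Field L] (γ : (Matrix (Fin n) (Fin n) L)ˣ)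
    (m : Fin n → ℤ) (x : Matrix.SpecialLinearGroup (Fin n) L) : L :=
  ∏ j : Fin n,
    ((((γ⁻¹ : (Matrix (Fin n) (Fin n) L)ˣ) : Matrix (Fin n) (Fin n) L) *
      (x : Matrix (Fin n) (Fin n) L) * (γ : Matrix (Fin n) (Fin n) L)) j j) ^ (m j)

/-- The restriction of a multivariate polynomial to the line `τ ↦ z + τ w`. -/
noncomputable def alongLine {ι L : Type*} [Field L] (z w : ι → L) :
    MvPolynomial ι L →ₐ[L] Polynomial L :=
  MvPolynomial.aeval fun i => Polynomial.C (z i) + Polynomial.X * Polynomial.C (w i)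

theorem alongLine_eval_zero {ι L : Type*} [Field L] (z w : ι → L) (f : MvPolynomial ι L) :
    (alongLine z w f).eval 0 = MvPolynomial.eval z f := by
  have : ((Polynomial.aeval (0 : L)).comp (alongLine z w)) = MvPolynomial.aeval z := by
    ext i
    simp [alongLine]
  have h := DFunLike.congr_fun this f
  simpa [Polynomial.aeval_def, MvPolynomial.aeval_eq_eval] using h

/-- The derivative of `f` at `z` in the direction `w`. -/
noncomputable def dirDeriv {ι L : Type*} [Field L] [Fintype ι] (z w : ι → L)
    (f : MvPolynomial ι L) : L :=
  ∑ i, w i * MvPolynomial.eval z (MvPolynomial.pderiv i f)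

section DirDeriv

variable {ι L : Type*} [Field L] [Fintype ι] (z w : ι → L)

theorem dirDeriv_add (p q : MvPolynomial ι L) :
    dirDeriv z w (p + q) = dirDeriv z w p + dirDeriv z w q := by
  simp [dirDeriv, mul_add, Finset.sum_add_distrib]

theorem dirDeriv_sub (p q : MvPolynomial ι L) :
    dirDeriv z w (p - q) = dirDeriv z w p - dirDeriv z w q := by
  simp [dirDeriv, mul_sub, Finset.sum_sub_distrib]

theorem dirDeriv_C (c : L) : dirDeriv z w (MvPolynomial.C c) = 0 := by
  simp [dirDeriv]

theorem dirDeriv_one : dirDeriv z w 1 = 0 := by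
  simp [dirDeriv]

theorem dirDeriv_X (j : ι) : dirDeriv z w (MvPolynomial.X j) = w j := by
  classical
  simp [dirDeriv, MvPolynomial.pderiv_X, Pi.single_apply, apply_ite]

theorem dirDeriv_mul (p q : MvPolynomial ι L) :
    dirDeriv z w (p * q) = dirDeriv z w p * MvPolynomial.eval z q +
      MvPolynomial.eval z p * dirDeriv z w q := by
  simp only [dirDeriv, Derivation.leibniz, smul_eq_mul, map_add, map_mul, mul_add,
    Finset.sum_add_distrib, Finset.sum_mul, Finset.mul_sum]
  rw [add_comm]
  congr 1 <;> exact Finset.sum_congr rfl fun i _ => by ring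

theorem dirDeriv_sum {κ : Type*} (s : Finset κ) (p : κ → MvPolynomial ι L) :
    dirDeriv z w (∑ k ∈ s, p k) = ∑ k ∈ s, dirDeriv z w (p k) := by
  simp only [dirDeriv, map_sum, Finset.mul_sum]
  exact Finset.sum_comm

end DirDeriv

theorem alongLine_derivative_eval_zero {ι L : Type*} [Field L] [Fintype ι]
    (z w : ι → L) (f : MvPolynomial ι L) :
    (Polynomial.derivative (alongLine z w f)).eval 0 = dirDeriv z w f := by
  induction f using MvPolynomial.induction_on with
  | C a => simp [alongLine, dirDeriv]
  | add p q hp hq => simp [hp, hq, dirDeriv_add]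
  | mul_X p j hp =>
    have hX : alongLine z w (MvPolynomial.X j) =
        Polynomial.C (z j) + Polynomial.X * Polynomial.C (w j) := by simp [alongLine]
    rw [map_mul, Polynomial.derivative_mul, Polynomial.eval_add, Polynomial.eval_mul,
      Polynomial.eval_mul, hp, alongLine_eval_zero, hX, dirDeriv_mul, dirDeriv_X]
    simp [alongLine_eval_zero]

/-- Polynomials of individual degrees at most `m` in `N` variables form a space of dimension at
most `(m + 1) ^ N`. -/
theorem card_le_of_linearIndependent_of_degreeOf_le {ι κ L : Type*} [Field L] [Fintype ι]
    [Fintype κ] (m : ℕ) (v : κ → MvPolynomial ι L) (hv : LinearIndependent L v)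
    (hdeg : ∀ k i, (v k).degreeOf i ≤ m) : Fintype.card κ ≤ (m + 1) ^ Fintype.card ι := by
  classical
  let φ : MvPolynomial ι L →ₗ[L] ((ι → Fin (m + 1)) → L) :=
    LinearMap.pi fun e => MvPolynomial.lcoeff L (Finsupp.equivFunOnFinite.symm fun i => (e i : ℕ))
  have hφ : LinearIndependent L (φ ∘ v) := by
    refine hv.map ?_
    have hspan : ∀ p ∈ Submodule.span L (Set.range v), ∀ i, p.degreeOf i ≤ m := by
      intro p hp
      have : Submodule.span L (Set.range v) ≤ MvPolynomial.restrictDegree ι L m := by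
        rw [Submodule.span_le]
        rintro _ ⟨k, rfl⟩
        rw [SetLike.mem_coe, MvPolynomial.mem_restrictDegree]
        exact fun s hs i => (MvPolynomial.degreeOf_le_iff.1 (hdeg k i)) s hs
      have h2 := this hp
      rw [MvPolynomial.mem_restrictDegree] at h2
      exact fun i => MvPolynomial.degreeOf_le_iff.2 fun s hs => h2 s hs i
    rw [Submodule.disjoint_def]
    intro p hp hker
    ext s
    rw [MvPolynomial.coeff_zero]
    by_contra hs
    have hs' : s ∈ p.support := MvPolynomial.mem_support_iff.2 hs
    have hle : ∀ i, s i < m + 1 := fun i =>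
      Nat.lt_succ_of_le ((MvPolynomial.degreeOf_le_iff.1 (hspan p hp i)) s hs')
    have := congrFun (LinearMap.mem_ker.1 hker) (fun i => ⟨s i, hle i⟩)
    apply hs
    simpa [φ, MvPolynomial.lcoeff] using this
  have := hφ.fintype_card_le_finrank
  simpa using this

theorem exists_separating_polynomial {ι L : Type*} [Field L] (Z : Finset (ι → L)) (z : ι → L) :
    ∃ h : MvPolynomial ι L, MvPolynomial.eval z h = 1 ∧
      (∀ z' ∈ Z, z' ≠ z → MvPolynomial.eval z' h = 0) ∧ h.totalDegree ≤ Z.card := by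
  classical
  have key : ∀ z' : ι → L, ∃ h : MvPolynomial ι L, MvPolynomial.eval z h = 1 ∧
      (z' ≠ z → MvPolynomial.eval z' h = 0) ∧ h.totalDegree ≤ 1 := by
    intro z'
    by_cases hz : z' = z
    · exact ⟨1, by simp, fun h => absurd hz h, by simp⟩
    · obtain ⟨i, hi⟩ := Function.ne_iff.1 hz
      refine ⟨MvPolynomial.C (z i - z' i)⁻¹ * (MvPolynomial.X i - MvPolynomial.C (z' i)),
        ?_, ?_, ?_⟩
      · have : z i - z' i ≠ 0 := sub_ne_zero.2 (Ne.symm hi)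
        simp [this]
      · intro _
        simp
      · refine (MvPolynomial.totalDegree_mul _ _).trans ?_
        rw [MvPolynomial.totalDegree_C, zero_add]
        refine (MvPolynomial.totalDegree_sub_C_le _ _).trans ?_
        rw [MvPolynomial.totalDegree_X]
  choose h h1 h2 h3 using key
  refine ⟨∏ z' ∈ Z, h z', ?_, ?_, ?_⟩
  · simp [map_prod, h1]
  · intro z' hz' hne
    rw [map_prod]
    exact Finset.prod_eq_zero hz' (h2 z' hne)
  · refine (MvPolynomial.totalDegree_finsetProd _ _).trans ?_
    refine (Finset.sum_le_sum fun z' _ => h3 z').trans ?_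
    simp

/-- If the polynomials `f i` vanish to exactly first order, and independently, at the points of
`Z`, then their monomials, localised at the points of `Z`, are linearly independent. -/
theorem linearIndependent_separating_mul_prod_pow {ι L : Type*} [Field L] [Infinite L] [Fintype ι]
    (f : ι → MvPolynomial ι L) (Z : Finset (ι → L)) (k : ℕ)
    (h0 : ∀ z ∈ Z, ∀ j, MvPolynomial.eval z (f j) = 0)
    (hnd : ∀ z ∈ Z, ∀ w : ι → L, (∀ j, dirDeriv z w (f j) = 0) → w = 0)
    (h : Z → MvPolynomial ι L) (h1 : ∀ z : Z, MvPolynomial.eval z (h z) = 1)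
    (h2 : ∀ z z' : Z, z' ≠ z → MvPolynomial.eval z' (h z) = 0) :
    LinearIndependent L
      (fun p : Z × (ι → Fin k) => h p.1 * ∏ i, f i ^ (p.2 i : ℕ)) := by
  classical
  rw [Fintype.linearIndependent_iff]
  intro c hc
  by_contra! hne
  obtain ⟨⟨z₀, α₀⟩, hmem, hmin⟩ := Finset.exists_min_image
    (Finset.univ.filter fun p : Z × (ι → Fin k) => c p ≠ 0) (fun p => ∑ i, (p.2 i : ℕ))
    (by obtain ⟨p, hp⟩ := hne; exact ⟨p, by simpa using hp⟩)
  have hc0 : c (z₀, α₀) ≠ 0 := by simpa using hmem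
  set a := ∑ i, (α₀ i : ℕ) with ha
  have hmin' : ∀ p, c p ≠ 0 → a ≤ ∑ i, (p.2 i : ℕ) := fun p hp => hmin p (by simpa using hp)
  let ℓ : (ι → L) →ₗ[L] (ι → L) := LinearMap.pi fun j =>
    ∑ i, (LinearMap.proj i).smulRight (MvPolynomial.eval (z₀ : ι → L) (MvPolynomial.pderiv i (f j)))
  have hℓ : ∀ w j, ℓ w j = dirDeriv (z₀ : ι → L) w (f j) := by
    intro w j
    simp [ℓ, dirDeriv]
  have hsurj : Function.Surjective ℓ := by
    rw [← LinearMap.injective_iff_surjective, ← LinearMap.ker_eq_bot, LinearMap.ker_eq_bot']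
    intro w hw
    exact hnd z₀ z₀.2 w fun j => by rw [← hℓ, hw]; rfl
  have hline : ∀ w, ∑ α : ι → Fin k,
      (if ∑ i, (α i : ℕ) = a then c (z₀, α) * ∏ i, (ℓ w i) ^ (α i : ℕ) else 0) = 0 := by
    intro w
    let F : ι → Polynomial L := fun i => Polynomial.divX (alongLine (z₀ : ι → L) w (f i))
    have hF : ∀ i, alongLine (z₀ : ι → L) w (f i) = Polynomial.X * F i := by
      intro i
      have := Polynomial.divX_mul_X_add (alongLine (z₀ : ι → L) w (f i))
      rw [Polynomial.coeff_zero_eq_eval_zero, alongLine_eval_zero, h0 z₀ z₀.2, map_zero,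
        add_zero] at this
      rw [← this, mul_comm]
    have hF0 : ∀ i, (F i).eval 0 = ℓ w i := by
      intro i
      rw [hℓ, ← alongLine_derivative_eval_zero, hF]
      simp [Polynomial.derivative_mul]
    have hsum : Polynomial.X ^ a * ∑ p : Z × (ι → Fin k),
        Polynomial.C (c p) * (alongLine (z₀ : ι → L) w (h p.1) *
          (Polynomial.X ^ (∑ i, (p.2 i : ℕ) - a) * ∏ i, F i ^ (p.2 i : ℕ))) = 0 := by
      have := congrArg (alongLine (z₀ : ι → L) w) hc
      rw [map_sum, map_zero] at this
      rw [← this, Finset.mul_sum]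
      refine Finset.sum_congr rfl fun p _ => ?_
      rw [map_smul, map_mul, map_prod, Polynomial.smul_eq_C_mul]
      simp only [map_pow, hF, mul_pow, Finset.prod_mul_distrib, Finset.prod_pow_eq_pow_sum]
      by_cases hp : c p = 0
      · simp [hp]
      · conv_rhs => rw [← Nat.sub_add_cancel (hmin' p hp), pow_add]
        ring
    have hsum' := (mul_eq_zero.1 hsum).resolve_left (pow_ne_zero _ Polynomial.X_ne_zero)
    have hev := congrArg (Polynomial.eval 0) hsum'
    rw [Polynomial.eval_finsetSum, Polynomial.eval_zero, Fintype.sum_prod_type,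
      Finset.sum_eq_single z₀] at hev
    · refine Eq.trans ?_ hev
      refine Finset.sum_congr rfl fun α _ => ?_
      rw [Polynomial.eval_mul, Polynomial.eval_mul, Polynomial.eval_mul, alongLine_eval_zero, h1,
        Polynomial.eval_prod, Polynomial.eval_C, Polynomial.eval_pow, Polynomial.eval_X]
      simp only [Polynomial.eval_pow, hF0]
      by_cases hα : ∑ i, (α i : ℕ) = a
      · simp [hα]
      · rw [if_neg hα]
        by_cases hp : c (z₀, α) = 0
        · simp [hp]
        · have h3 := hmin' _ hp
          rw [zero_pow (by simp only at h3; omega)]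
          simp
    · intro z _ hz
      refine Finset.sum_eq_zero fun α _ => ?_
      rw [Polynomial.eval_mul, Polynomial.eval_mul, alongLine_eval_zero, h2 z z₀ (Ne.symm hz)]
      simp
    · simp
  let P : MvPolynomial ι L := ∑ α : ι → Fin k, if ∑ i, (α i : ℕ) = a then
    MvPolynomial.monomial (Finsupp.equivFunOnFinite.symm fun i => (α i : ℕ)) (c (z₀, α)) else 0
  have hP : P = 0 := by
    refine MvPolynomial.funext fun v => ?_
    obtain ⟨w, rfl⟩ := hsurj v
    rw [map_zero, ← hline w, map_sum]
    refine Finset.sum_congr rfl fun α _ => ?_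
    split_ifs
    · rw [MvPolynomial.eval_monomial, Finsupp.prod_fintype _ _ (by simp)]
      simp
    · simp
  apply hc0
  have hcoeff := congrArg
    (MvPolynomial.coeff (Finsupp.equivFunOnFinite.symm fun i => (α₀ i : ℕ))) hP
  rw [MvPolynomial.coeff_sum, Finset.sum_eq_single α₀] at hcoeff
  · simpa [← ha] using hcoeff
  · intro α _ hα
    split_ifs
    · rw [MvPolynomial.coeff_monomial, if_neg]
      intro heq
      apply hα
      have := Finsupp.equivFunOnFinite.symm.injective heq
      funext i
      exact Fin.ext (congrFun this i)
    · simp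
  · simp

/-- A Bézout-type bound: a square system of polynomials of degree at most `d` in `N` variables has
at most `(N d + 2) ^ N` zeros at which its Jacobian is nonsingular. -/
theorem card_nondegenerate_zeros_le {ι L : Type*} [Field L] [Infinite L] [Fintype ι] (d : ℕ)
    (f : ι → MvPolynomial ι L) (hd : ∀ j, (f j).totalDegree ≤ d) (Z : Finset (ι → L))
    (h0 : ∀ z ∈ Z, ∀ j, MvPolynomial.eval z (f j) = 0)
    (hnd : ∀ z ∈ Z, ∀ w : ι → L, (∀ j, dirDeriv z w (f j) = 0) → w = 0) :
    Z.card ≤ (Fintype.card ι * d + 2) ^ Fintype.card ι := by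
  classical
  rcases Z.eq_empty_or_nonempty with rfl | hZ
  · simp
  choose h h1 h2 h3 using fun z : Z => exists_separating_polynomial Z (z : ι → L)
  have hli := linearIndependent_separating_mul_prod_pow f Z Z.card h0 hnd h h1
    (fun z z' hz => h2 z z' z'.2 (fun he => hz (Subtype.ext he)))
  have hcard := card_le_of_linearIndependent_of_degreeOf_le
    (Z.card + Fintype.card ι * (Z.card * d)) _ hli (by
      rintro ⟨z, α⟩ i
      refine (MvPolynomial.degreeOf_le_totalDegree _ _).trans ?_
      refine (MvPolynomial.totalDegree_mul _ _).trans (add_le_add (h3 z) ?_)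
      refine (MvPolynomial.totalDegree_finsetProd _ _).trans ?_
      refine (Finset.sum_le_card_nsmul _ _ (Z.card * d) fun j _ => ?_).trans ?_
      · refine (MvPolynomial.totalDegree_pow _ _).trans ?_
        exact Nat.mul_le_mul (α j).2.le (hd j)
      · simp)
  have hpos : 0 < Z.card := hZ.card_pos
  simp only [Fintype.card_prod, Fintype.card_coe, Fintype.card_fun, Fintype.card_fin] at hcard
  have hle : Z.card + Fintype.card ι * (Z.card * d) + 1 ≤
      Z.card * (Fintype.card ι * d + 2) := by nlinarith
  have hfin := hcard.trans (Nat.pow_le_pow_left hle _)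
  rw [mul_pow, mul_comm] at hfin
  exact Nat.le_of_mul_le_mul_left hfin (pow_pos hpos _)

/-- The space of affine-linear functions on square matrices; its `D`-th power is the space of
polynomial functions of degree at most `D`. -/
def affineFun (ι L : Type*) [Field L] : Submodule L (Matrix ι ι L → L) :=
  Submodule.span L (insert 1 (Set.range fun p : ι × ι => fun g : Matrix ι ι L => g p.1 p.2))

section PolynomialFunctions

variable {ι L : Type*} [Field L]

theorem one_le_affineFun : (1 : Submodule L (Matrix ι ι L → L)) ≤ affineFun ι L :=
  Submodule.one_le.2 (Submodule.subset_span (Set.mem_insert _ _))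

theorem affineFun_pow_mono {a b : ℕ} (h : a ≤ b) : affineFun ι L ^ a ≤ affineFun ι L ^ b :=
  pow_le_pow_right' one_le_affineFun h

theorem const_mem_affineFun_pow (c : L) (a : ℕ) :
    (fun _ => c : Matrix ι ι L → L) ∈ affineFun ι L ^ a := by
  refine affineFun_pow_mono (Nat.zero_le a) ?_
  rw [pow_zero]
  exact Submodule.mem_one.2 ⟨c, rfl⟩

theorem entry_mem_affineFun (i j : ι) : (fun g : Matrix ι ι L => g i j) ∈ affineFun ι L :=
  Submodule.subset_span (Set.mem_insert_of_mem _ ⟨(i, j), rfl⟩)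

theorem prod_mem_affineFun_pow {κ : Type*} (s : Finset κ) (a : ℕ) (f : κ → Matrix ι ι L → L)
    (hf : ∀ k ∈ s, f k ∈ affineFun ι L ^ a) : ∏ k ∈ s, f k ∈ affineFun ι L ^ (a * s.card) := by
  classical
  induction s using Finset.induction_on with
  | empty => exact const_mem_affineFun_pow (1 : L) _
  | insert k s hk ih =>
    rw [Finset.prod_insert hk, Finset.card_insert_of_notMem hk, mul_add, mul_one, add_comm,
      pow_add]
    exact Submodule.mul_mem_mul (hf k (Finset.mem_insert_self _ _))
      (ih fun k' hk' => hf k' (Finset.mem_insert_of_mem hk'))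

theorem det_mem_affineFun_pow {κ : Type*} [Fintype κ] [DecidableEq κ] (a : ℕ)
    (M : Matrix ι ι L → Matrix κ κ L) (hM : ∀ p q, (fun g => M g p q) ∈ affineFun ι L ^ a) :
    (fun g => (M g).det) ∈ affineFun ι L ^ (a * Fintype.card κ) := by
  have : (fun g => (M g).det) = ∑ σ : Equiv.Perm κ, ((Equiv.Perm.sign σ : ℤ) : L) •
      ∏ i, (fun g => M g (σ i) i) := by
    funext g
    rw [Matrix.det_apply']
    simp [Finset.sum_apply, Finset.prod_apply]
  rw [this]
  exact Submodule.sum_mem _ fun σ _ => Submodule.smul_mem _ _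
    (prod_mem_affineFun_pow Finset.univ a _ fun i _ => hM _ _)

theorem comp_mem_affineFun_pow {D : ℕ} (T : Matrix ι ι L → Matrix ι ι L)
    (hT : ∀ p q, (fun g => T g p q) ∈ affineFun ι L) {f : Matrix ι ι L → L}
    (hf : f ∈ affineFun ι L ^ D) : f ∘ T ∈ affineFun ι L ^ D := by
  induction hf using Submodule.pow_induction_on_left' with
  | algebraMap r => exact const_mem_affineFun_pow r 0
  | add x y i hx hy ihx ihy => exact Submodule.add_mem _ ihx ihy
  | mem_mul m hm i x hx ih =>
    rw [pow_succ']
    refine Submodule.mul_mem_mul (m := m ∘ T) ?_ ih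
    clear ih
    induction hm using Submodule.span_induction with
    | mem x h =>
      rcases h with rfl | ⟨⟨p, q⟩, rfl⟩
      · exact Submodule.subset_span (Set.mem_insert _ _)
      · exact hT p q
    | zero => exact Submodule.zero_mem _
    | add x y _ _ hx hy => exact Submodule.add_mem _ hx hy
    | smul a x _ hx => exact Submodule.smul_mem _ a hx

theorem comp_mul_mul_mem_affineFun_pow [Fintype ι] {D : ℕ} (P Q : Matrix ι ι L)
    {f : Matrix ι ι L → L} (hf : f ∈ affineFun ι L ^ D) :
    (fun g => f (P * g * Q)) ∈ affineFun ι L ^ D := by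
  refine comp_mem_affineFun_pow (fun g => P * g * Q) (fun p q => ?_) hf
  have : (fun g : Matrix ι ι L => (P * g * Q) p q) =
      ∑ k, ∑ l, (P p l * Q k q) • (fun g : Matrix ι ι L => g l k) := by
    funext g
    simp only [Matrix.mul_apply, Finset.sum_apply, Finset.sum_mul, Pi.smul_apply, smul_eq_mul]
    exact Finset.sum_congr rfl fun k _ => Finset.sum_congr rfl fun l _ => by ring
  rw [this]
  exact Submodule.sum_mem _ fun k _ => Submodule.sum_mem _ fun l _ =>
    Submodule.smul_mem _ _ (entry_mem_affineFun l k)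

theorem finite_affineFun_pow [Fintype ι] (D : ℕ) : Module.Finite L ↥(affineFun ι L ^ D) := by
  rw [Module.Finite.iff_fg]
  exact Submodule.FG.pow (Submodule.fg_span ((Set.finite_range _).insert _)) D

theorem finrank_affineFun_pow_le [Fintype ι] (D : ℕ) :
    Module.finrank L ↥(affineFun ι L ^ D) ≤ (Fintype.card ι * Fintype.card ι + 1) ^ D := by
  classical
  let s : Finset (Matrix ι ι L → L) :=
    insert 1 (Finset.univ.image fun p : ι × ι => fun g : Matrix ι ι L => g p.1 p.2)
  have hs : affineFun ι L = Submodule.span L (s : Set (Matrix ι ι L → L)) := by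
    simp [affineFun, s]
  rw [hs, Submodule.span_pow, ← Finset.coe_pow]
  refine (finrank_span_finset_le_card _).trans (Finset.card_pow_le.trans ?_)
  refine Nat.pow_le_pow_left ((Finset.card_insert_le _ _).trans ?_) _
  refine Nat.succ_le_succ (Finset.card_image_le.trans ?_)
  simp

/-- Along a line in matrix space, a polynomial function of degree at most `D` restricts to a
polynomial of degree at most `D`. -/
theorem exists_polynomial_of_mem_affineFun_pow {D : ℕ} (P Q : Matrix ι ι L)
    {f : Matrix ι ι L → L} (hf : f ∈ affineFun ι L ^ D) :
    ∃ p : Polynomial L, p.natDegree ≤ D ∧ ∀ x, f (P + x • Q) = p.eval x := by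
  induction hf using Submodule.pow_induction_on_left' with
  | algebraMap r => exact ⟨Polynomial.C r, by simp, fun x => by simp⟩
  | add x y i hx hy ihx ihy =>
    obtain ⟨p, hp, hp'⟩ := ihx
    obtain ⟨q, hq, hq'⟩ := ihy
    exact ⟨p + q, Polynomial.natDegree_add_le_of_degree_le hp hq, fun t => by simp [hp', hq']⟩
  | mem_mul m hm i x hx ih =>
    obtain ⟨p, hp, hp'⟩ := ih
    have : ∃ q : Polynomial L, q.natDegree ≤ 1 ∧ ∀ x, m (P + x • Q) = q.eval x := by
      clear hp'
      induction hm using Submodule.span_induction with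
      | mem x h =>
        rcases h with rfl | ⟨⟨a, b⟩, rfl⟩
        · exact ⟨1, by simp, fun x => by simp⟩
        · refine ⟨Polynomial.C (Q a b) * Polynomial.X + Polynomial.C (P a b),
            Polynomial.natDegree_linear_le, fun x => ?_⟩
          simp
          ring
      | zero => exact ⟨0, by simp, fun x => by simp⟩
      | add x y _ _ hx hy =>
        obtain ⟨p, hp, hp'⟩ := hx
        obtain ⟨q, hq, hq'⟩ := hy
        exact ⟨p + q, Polynomial.natDegree_add_le_of_degree_le hp hq,
          fun t => by simp [hp', hq']⟩
      | smul a x _ hx =>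
        obtain ⟨p, hp, hp'⟩ := hx
        exact ⟨a • p, (Polynomial.natDegree_smul_le _ _).trans hp, fun t => by simp [hp']⟩
    obtain ⟨q, hq, hq'⟩ := this
    refine ⟨q * p, Polynomial.natDegree_mul_le.trans (by omega), fun t => ?_⟩
    simp [hp', hq']

end PolynomialFunctions

namespace Matrix.SpecialLinearGroup

variable {ι L : Type*} [Field L] [Fintype ι] [DecidableEq ι]

theorem diag2n_eq_prod_transvection {i j : ι} (hij : i ≠ j) {c : L} (hc : c ≠ 0) :
    diag2n hij c hc =
      transvection hij c * transvection hij.symm (-c⁻¹) * transvection hij c *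
        (transvection hij (-1) * transvection hij.symm 1 * transvection hij (-1)) := by
  apply Subtype.ext
  have hne : i ≠ j := hij
  have hne' : j ≠ i := hij.symm
  simp only [coe_mul, transvection_coe]
  simp only [mul_add, add_mul, mul_one, one_mul, single_mul_single_same,
    single_mul_single_of_ne _ _ _ _ hne, single_mul_single_of_ne _ _ _ _ hne', add_zero]
  rw [diag2n_coe]
  ext k l
  simp only [add_apply, single_apply, diagonal_apply, one_apply]
  by_cases hki : k = i <;> by_cases hkj : k = j <;> by_cases hli : l = i <;>
    by_cases hlj : l = j <;> subst_vars <;> simp_all [eq_comm]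

/-- Over a field, `SL_n` is generated by transvections. -/
theorem transvection_induction [Nontrivial ι] (P : SpecialLinearGroup ι L → Prop)
    (M : SpecialLinearGroup ι L)
    (htransvec : ∀ (i j : ι) (hij : i ≠ j) (a : L), P (transvection hij a))
    (hmul : ∀ A B, P A → P B → P (A * B)) : P M := by
  refine diagonal_transvection_induction' P M (fun i j hij c hc => ?_) htransvec hmul
  rw [diag2n_eq_prod_transvection]
  exact hmul _ _ (hmul _ _ (hmul _ _ (htransvec _ _ _ _) (htransvec _ _ _ _)) (htransvec _ _ _ _))
    (hmul _ _ (hmul _ _ (htransvec _ _ _ _) (htransvec _ _ _ _)) (htransvec _ _ _ _))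

end Matrix.SpecialLinearGroup

section Escape

variable {ι K L : Type*} [Field K] [Field L] [Algebra K L] [Fintype ι] [DecidableEq ι]

/-- A polynomial function of degree less than `|K|` that vanishes on `SL_n(K)` vanishes on
`SL_n(L)` for every extension `L` of `K`. -/
theorem vanish_of_vanish_on_subfield [Nontrivial ι] [Fintype K] {D : ℕ} (hD : D < Fintype.card K)
    (f : Matrix ι ι L → L) (hf : f ∈ affineFun ι L ^ D)
    (h0 : ∀ x : Matrix.SpecialLinearGroup ι K,
      f (Matrix.SpecialLinearGroup.map (algebraMap K L) x).1 = 0)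
    (g : Matrix.SpecialLinearGroup ι L) : f g = 0 := by
  classical
  suffices H : ∀ f ∈ affineFun ι L ^ D, (∀ x : Matrix.SpecialLinearGroup ι K,
      f (Matrix.SpecialLinearGroup.map (algebraMap K L) x).1 = 0) →
      ∀ x : Matrix.SpecialLinearGroup ι K,
      f ((Matrix.SpecialLinearGroup.map (algebraMap K L) x).1 * g.1) = 0 by
    simpa using H f hf h0 1
  refine Matrix.SpecialLinearGroup.transvection_induction (fun g =>
    ∀ f ∈ affineFun ι L ^ D, (∀ x : Matrix.SpecialLinearGroup ι K,
      f (Matrix.SpecialLinearGroup.map (algebraMap K L) x).1 = 0) →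
      ∀ x : Matrix.SpecialLinearGroup ι K,
      f ((Matrix.SpecialLinearGroup.map (algebraMap K L) x).1 * g.1) = 0) g ?_ ?_
  · intro i j hij a f hf h0 x
    let X : Matrix ι ι L := (Matrix.SpecialLinearGroup.map (algebraMap K L) x).1
    obtain ⟨p, hp, hpx⟩ := exists_polynomial_of_mem_affineFun_pow X (X * Matrix.single i j 1) hf
    have htr : ∀ b : L, X * (Matrix.SpecialLinearGroup.transvection hij b).1 =
        X + b • (X * Matrix.single i j 1) := by
      intro b
      rw [Matrix.SpecialLinearGroup.transvection_coe, mul_add, mul_one, ← Matrix.mul_smul,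
        Matrix.smul_single, smul_eq_mul, mul_one]
    have hp0 : p = 0 := by
      refine Polynomial.eq_zero_of_natDegree_lt_card_of_eval_eq_zero p
        (FaithfulSMul.algebraMap_injective K L) (fun b => ?_) (hp.trans_lt hD)
      rw [← hpx, ← htr]
      have := h0 (x * Matrix.SpecialLinearGroup.transvection hij b)
      rw [map_mul] at this
      convert this using 2
      rw [Matrix.SpecialLinearGroup.coe_mul]
      congr 1
      ext u v
      simp [Matrix.SpecialLinearGroup.transvection_coe, Matrix.single_apply, Matrix.one_apply,
        apply_ite (algebraMap K L)]
    have := hpx a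
    rw [hp0, Polynomial.eval_zero, ← htr] at this
    exact this
  · intro g₁ g₂ h₁ h₂ f hf h0 x
    have := h₁ (fun y => f (1 * y * g₂.1)) (comp_mul_mul_mem_affineFun_pow _ _ hf)
      (fun x => by rw [one_mul]; exact h₂ f hf h0 x) x
    simpa [mul_assoc] using this

/-- The polynomial functions of degree at most `D` on matrices that vanish at the `ρ`-image
of `X`. -/
def vanishingFun {G : Type*} (D : ℕ) (ρ : G → Matrix ι ι L) (X : Finset G) :
    Submodule L (Matrix ι ι L → L) where
  carrier := {f | f ∈ affineFun ι L ^ D ∧ ∀ x ∈ X, f (ρ x) = 0}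
  zero_mem' := ⟨Submodule.zero_mem _, fun _ _ => rfl⟩
  add_mem' := fun {a b} ha hb => ⟨Submodule.add_mem _ ha.1 hb.1, fun x hx => by
    simp [ha.2 x hx, hb.2 x hx]⟩
  smul_mem' := fun c f hf => ⟨Submodule.smul_mem _ c hf.1, fun x hx => by simp [hf.2 x hx]⟩

omit [DecidableEq ι] in
/-- If `A` generates a group of matrices, a bounded number of products of boundedly many elements
of `A` detect the vanishing of all polynomial functions of degree at most `D` on the group. -/
theorem exists_finset_prodSet_detecting {G : Type*} [Group G] (A : Set G)
    (hA : Subgroup.closure A = ⊤) (D : ℕ) (ρ : G → Matrix ι ι L)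
    (hρ : ∀ x y, ρ (x * y) = ρ x * ρ y) :
    ∃ X : Finset G, (X : Set G) ⊆ prodSet A ((Fintype.card ι * Fintype.card ι + 1) ^ D) ∧
      X.card ≤ (Fintype.card ι * Fintype.card ι + 1) ^ D + 1 ∧
      ∀ f ∈ affineFun ι L ^ D, (∀ x ∈ X, f (ρ x) = 0) → ∀ g, f (ρ g) = 0 := by
  classical
  set d := (Fintype.card ι * Fintype.card ι + 1) ^ D with hd
  have hfin : Module.Finite L ↥(affineFun ι L ^ D) := finite_affineFun_pow D
  have hle : ∀ X : Finset G, vanishingFun D ρ X ≤ affineFun ι L ^ D := fun X f hf => hf.1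
  have hfinX : ∀ X : Finset G, Module.Finite L ↥(vanishingFun D ρ X) := fun X =>
    Submodule.finiteDimensional_of_le (hle X)
  have hmono : ∀ a b : ℕ, a ≤ b → prodSet A a ⊆ prodSet A b := fun a b hab =>
    Set.pow_subset_pow_right (Set.mem_union_right _ rfl) hab
  have step : ∀ i : ℕ, ∃ X : Finset G, (X : Set G) ⊆ prodSet A i ∧ X.card ≤ i + 1 ∧ 1 ∈ X ∧
      ((∀ f ∈ affineFun ι L ^ D, (∀ x ∈ X, f (ρ x) = 0) → ∀ g, f (ρ g) = 0) ∨
        Module.finrank L ↥(vanishingFun D ρ X) + i ≤ d) := by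
    intro i
    induction i with
    | zero =>
      refine ⟨{1}, by simp [prodSet], by simp, by simp, Or.inr ?_⟩
      exact (Submodule.finrank_mono (hle _)).trans (finrank_affineFun_pow_le D)
    | succ i ih =>
      obtain ⟨X, hXA, hXc, h1, h⟩ := ih
      by_cases hX : ∀ f ∈ affineFun ι L ^ D, (∀ x ∈ X, f (ρ x) = 0) → ∀ g, f (ρ g) = 0
      · exact ⟨X, hXA.trans (hmono _ _ i.le_succ), hXc.trans (by omega), h1, Or.inl hX⟩
      have h := h.resolve_left hX
      have hex : ∃ f ∈ vanishingFun D ρ X, ∃ a ∈ A ∪ A⁻¹, ∃ x ∈ X, f (ρ (x * a)) ≠ 0 := by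
        by_contra! hcon
        apply hX
        have hall : ∀ g ∈ Submonoid.closure (A ∪ A⁻¹), ∀ f ∈ vanishingFun D ρ X,
            ∀ x ∈ X, f (ρ (x * g)) = 0 := by
          intro g hg
          induction hg using Submonoid.closure_induction with
          | mem a ha => exact fun f hf x hx => hcon f hf a ha x hx
          | one => exact fun f hf x hx => by simpa using hf.2 x hx
          | mul a b _ _ hab hb =>
            intro f hf x hx
            have hf' : (fun g => f (g * ρ b)) ∈ vanishingFun D ρ X := by
              refine ⟨?_, fun y hy => ?_⟩
              · simpa using comp_mul_mul_mem_affineFun_pow 1 (ρ b) hf.1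
              · change f (ρ y * ρ b) = 0
                rw [← hρ]
                exact hb f hf y hy
            have := hab _ hf' x hx
            change f (ρ (x * a) * ρ b) = 0 at this
            rwa [← hρ, mul_assoc] at this
        intro f hf hfX g
        have hg : g ∈ Submonoid.closure (A ∪ A⁻¹) := by
          rw [← Subgroup.closure_toSubmonoid, hA]
          trivial
        simpa using hall g hg f ⟨hf, hfX⟩ 1 h1
      obtain ⟨f, hf, a, ha, x, hx, hne⟩ := hex
      refine ⟨insert (x * a) X, ?_, ?_, Finset.mem_insert_of_mem h1, Or.inr ?_⟩
      · rw [Finset.coe_insert, Set.insert_subset_iff]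
        refine ⟨?_, hXA.trans (hmono _ _ i.le_succ)⟩
        rw [prodSet, pow_succ]
        exact Set.mul_mem_mul (hXA hx) (Set.mem_union_left _ ha)
      · exact (Finset.card_insert_le _ _).trans (by omega)
      · have hlt : vanishingFun D ρ (insert (x * a) X) < vanishingFun D ρ X := by
          refine lt_of_le_of_ne (fun f hf => ⟨hf.1, fun y hy =>
            hf.2 y (Finset.mem_insert_of_mem hy)⟩) fun heq => hne ?_
          rw [← heq] at hf
          exact hf.2 _ (Finset.mem_insert_self _ _)
        have := Submodule.finrank_lt_finrank_of_lt hlt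
        omega
  obtain ⟨X, hXA, hXc, h1, hX | hX⟩ := step d
  · exact ⟨X, hXA, hXc, hX⟩
  · refine ⟨X, hXA, hXc, fun f hf hfX g => ?_⟩
    have h0 : Module.finrank L ↥(vanishingFun D ρ X) = 0 := by omega
    rw [Submodule.finrank_eq_zero] at h0
    have : f ∈ vanishingFun D ρ X := ⟨hf, hfX⟩
    rw [h0, Submodule.mem_bot] at this
    rw [this]
    rfl

/-- Escape from subvarieties for a conjugate of `SL_n(K)` in `SL_n(L)`. -/
theorem exists_finset_prodSet_detecting_specialLinearGroup [Nontrivial ι] [Fintype K] {D : ℕ}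
    (hD : D < Fintype.card K) (A : Set (Matrix.SpecialLinearGroup ι K))
    (hA : Subgroup.closure A = ⊤)
    (ρ : Matrix.SpecialLinearGroup ι K →* Matrix.SpecialLinearGroup ι L) (γ : (Matrix ι ι L)ˣ)
    (hρ : ∀ x, (ρ x).1 =
      (γ⁻¹).1 * (Matrix.SpecialLinearGroup.map (algebraMap K L) x).1 * γ.1) :
    ∃ X : Finset (Matrix.SpecialLinearGroup ι K),
      (X : Set _) ⊆ prodSet A ((Fintype.card ι * Fintype.card ι + 1) ^ D) ∧
      X.card ≤ (Fintype.card ι * Fintype.card ι + 1) ^ D + 1 ∧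
      ∀ f ∈ affineFun ι L ^ D, (∀ x ∈ X, f (ρ x).1 = 0) →
        ∀ g : Matrix.SpecialLinearGroup ι L, f g.1 = 0 := by
  obtain ⟨X, hXA, hXc, hX⟩ := exists_finset_prodSet_detecting A hA D (fun x => (ρ x).1)
    (fun x y => by rw [map_mul]; rfl)
  refine ⟨X, hXA, hXc, fun f hf hfX g => ?_⟩
  have h1 := hX f hf hfX
  have hdet : (γ.1 * g.1 * (γ⁻¹).1).det = 1 := by
    rw [Matrix.det_mul, Matrix.det_mul, mul_right_comm, ← Matrix.det_mul]
    simp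
  have := vanish_of_vanish_on_subfield hD (fun y => f ((γ⁻¹).1 * y * γ.1))
    (comp_mul_mul_mem_affineFun_pow _ _ hf) (fun x => by rw [← hρ]; exact h1 x)
    ⟨γ.1 * g.1 * (γ⁻¹).1, hdet⟩
  simpa [mul_assoc] using this

end Escape

/-- A matrix with trivial kernel has a nonzero maximal minor. -/
theorem Matrix.exists_det_submatrix_ne_zero {J C L : Type*} [Field L] [Fintype J] [Fintype C]
    [DecidableEq C] (M : Matrix J C L) (hM : ∀ v, M.mulVec v = 0 → v = 0) :
    ∃ e : C → J, (M.submatrix e id).det ≠ 0 := by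
  classical
  have hspan : Submodule.span L (Set.range M.row) = ⊤ := by
    apply Submodule.eq_top_of_finrank_eq
    rw [← Matrix.rank_eq_finrank_span_row]
    have hinj : Function.Injective M.mulVecLin := by
      rw [← LinearMap.ker_eq_bot, LinearMap.ker_eq_bot']
      exact fun v hv => hM v hv
    rw [Matrix.rank, LinearMap.finrank_range_of_inj hinj]
  obtain ⟨κ, a, ha, hsp, hli⟩ := exists_linearIndependent' L M.row
  have hκ : Finite κ := Finite.of_injective a ha
  have := Fintype.ofFinite κ
  let b := Module.Basis.mk hli (by rw [hsp, hspan])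
  have hcard : Fintype.card C = Fintype.card κ := by
    rw [← Module.finrank_eq_card_basis b, Module.finrank_fintype_fun_eq_card]
  let eqv : C ≃ κ := Fintype.equivOfCardEq hcard
  refine ⟨a ∘ eqv, ?_⟩
  have hli' : LinearIndependent L (M.submatrix (a ∘ eqv) id).row :=
    hli.comp eqv eqv.injective
  have := (Matrix.linearIndependent_rows_iff_isUnit.1 hli')
  exact ((Matrix.isUnit_iff_isUnit_det _).1 this).ne_zero

section Tangent

variable {ι κ L : Type*} [Field L] [Fintype ι] [DecidableEq ι]

/-- The matrix of the linear map sending `(ε_a)` to `∑ a, H_a diag(ε_a) H_a⁻¹`, extended by the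
equations of the Lie algebra `{ε : ∑ ε_i = 0, ∑ m_i ε_i = 0}` in each component. -/
def tangentMatrix [DecidableEq κ] (m : ι → ℤ) (H : κ → Matrix ι ι L) :
    Matrix ((ι × ι) ⊕ (κ ⊕ κ)) (κ × ι) L :=
  Matrix.of fun r s => match r with
    | Sum.inl (p, q) => H s.1 p s.2 * (H s.1).adjugate s.2 q
    | Sum.inr (Sum.inl b) => if b = s.1 then 1 else 0
    | Sum.inr (Sum.inr b) => if b = s.1 then (m s.2 : L) else 0

variable [Fintype κ] [DecidableEq κ]

theorem tangentMatrix_mulVec_inl (m : ι → ℤ) (H : κ → Matrix ι ι L) (ε : κ × ι → L) (p q : ι) :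
    (tangentMatrix m H).mulVec ε (Sum.inl (p, q)) =
      ∑ a, (H a * Matrix.diagonal (fun i => ε (a, i)) * (H a).adjugate) p q := by
  simp only [Matrix.mulVec, dotProduct, tangentMatrix, Matrix.of_apply, Fintype.sum_prod_type]
  refine Finset.sum_congr rfl fun a _ => ?_
  rw [Matrix.mul_apply]
  refine Finset.sum_congr rfl fun i _ => ?_
  rw [Matrix.mul_diagonal]
  ring

theorem tangentMatrix_mulVec_inr_inl (m : ι → ℤ) (H : κ → Matrix ι ι L) (ε : κ × ι → L) (b : κ) :
    (tangentMatrix m H).mulVec ε (Sum.inr (Sum.inl b)) = ∑ i, ε (b, i) := by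
  simp only [Matrix.mulVec, dotProduct, tangentMatrix, Matrix.of_apply, Fintype.sum_prod_type]
  rw [Finset.sum_eq_single b]
  · simp
  · intro a _ ha
    simp [Ne.symm ha]
  · simp

theorem tangentMatrix_mulVec_inr_inr (m : ι → ℤ) (H : κ → Matrix ι ι L) (ε : κ × ι → L) (b : κ) :
    (tangentMatrix m H).mulVec ε (Sum.inr (Sum.inr b)) = ∑ i, (m i : L) * ε (b, i) := by
  simp only [Matrix.mulVec, dotProduct, tangentMatrix, Matrix.of_apply, Fintype.sum_prod_type]
  rw [Finset.sum_eq_single b]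
  · simp
  · intro a _ ha
    simp [Ne.symm ha]
  · simp

omit [Fintype κ] [DecidableEq κ] in
theorem one_add_vecMulVec_conj_diagonal (u w : ι → L) (huw : ∀ k, u k * w k = 0) (ε : ι → L)
    (p q : ι) :
    ((1 + Matrix.vecMulVec u w) * Matrix.diagonal ε * (1 - Matrix.vecMulVec u w)) p q =
      (if p = q then ε p else 0) + u p * w q * (ε q - ε p) := by
  have h : Matrix.vecMulVec u w * Matrix.diagonal ε * Matrix.vecMulVec u w = 0 := by
    ext i j
    rw [Matrix.mul_apply, Matrix.zero_apply]
    refine Finset.sum_eq_zero fun k _ => ?_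
    rw [Matrix.mul_diagonal, Matrix.vecMulVec_apply, Matrix.vecMulVec_apply]
    linear_combination (u i * ε k * w j) * huw k
  have : (1 + Matrix.vecMulVec u w) * Matrix.diagonal ε * (1 - Matrix.vecMulVec u w) =
      Matrix.diagonal ε + Matrix.vecMulVec u w * Matrix.diagonal ε -
        Matrix.diagonal ε * Matrix.vecMulVec u w := by
    rw [add_mul, one_mul, mul_sub, mul_one, add_mul, h, add_zero]
  rw [this, Matrix.sub_apply, Matrix.add_apply, Matrix.mul_diagonal, Matrix.diagonal_mul,
    Matrix.diagonal_apply, Matrix.vecMulVec_apply]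
  ring

omit [Fintype κ] [DecidableEq κ] in
theorem det_one_add_vecMulVec_eq_one (u w : ι → L) (huw : ∀ k, u k * w k = 0) :
    (1 + Matrix.vecMulVec u w).det = 1 := by
  rw [Matrix.vecMulVec_eq Unit, Matrix.det_one_add_replicateCol_mul_replicateRow]
  simp [dotProduct, mul_comm, huw]

omit [Fintype κ] [DecidableEq κ] in
theorem adjugate_one_add_vecMulVec (u w : ι → L) (huw : ∀ k, u k * w k = 0) :
    (1 + Matrix.vecMulVec u w).adjugate = 1 - Matrix.vecMulVec u w := by
  have hsq : Matrix.vecMulVec u w * Matrix.vecMulVec u w = 0 := by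
    ext i j
    rw [Matrix.mul_apply, Matrix.zero_apply]
    refine Finset.sum_eq_zero fun k _ => ?_
    rw [Matrix.vecMulVec_apply, Matrix.vecMulVec_apply]
    linear_combination (u i * w j) * huw k
  have h1 : (1 + Matrix.vecMulVec u w) * (1 - Matrix.vecMulVec u w) = 1 := by
    rw [mul_sub, mul_one, add_mul, one_mul, hsq, add_zero, add_sub_cancel_right]
  have h2 := Matrix.adjugate_mul (1 + Matrix.vecMulVec u w)
  rw [det_one_add_vecMulVec_eq_one u w huw, one_smul] at h2
  calc _ = (1 + Matrix.vecMulVec u w).adjugate *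
        ((1 + Matrix.vecMulVec u w) * (1 - Matrix.vecMulVec u w)) := by rw [h1, mul_one]
    _ = _ := by rw [← mul_assoc, h2, one_mul]

/-- The column vector of the unipotent element indexed by `a`. -/
def unipotentCol (c : ι) : Option (Option ι) → ι → L
  | none => 0
  | some none => fun k => if k = c then 0 else 1
  | some (some i) => Pi.single i 1

/-- The row vector of the unipotent element indexed by `a`. -/
def unipotentRow (c : ι) : Option (Option ι) → ι → L
  | none => 0
  | some none => Pi.single c 1
  | some (some i) => fun k => if k = i then 0 else 1

omit [Fintype ι] [Fintype κ] [DecidableEq κ] in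
theorem unipotentCol_mul_unipotentRow (c : ι) (a : Option (Option ι)) (k : ι) :
    unipotentCol c a k * (unipotentRow c a k : L) = 0 := by
  rcases a with _ | _ | i
  · simp [unipotentCol]
  · by_cases h : k = c <;> simp [unipotentCol, unipotentRow, h]
  · by_cases h : k = i <;> simp [unipotentCol, unipotentRow, h]

/-- There are `n + 2` conjugates of the Lie algebra of `T'` that are linearly independent. -/
theorem exists_tangentMatrix_injective (hN : (Fintype.card ι : L) ≠ 0) (m : ι → ℤ) (c : ι)
    (hc : (Fintype.card ι : L) * m c ≠ ∑ i, (m i : L)) :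
    ∃ H : Option (Option ι) → Matrix ι ι L, (∀ a, (H a).det = 1) ∧
      ∀ ε, (tangentMatrix m H).mulVec ε = 0 → ε = 0 := by
  refine ⟨fun a => 1 + Matrix.vecMulVec (unipotentCol c a) (unipotentRow c a),
    fun a => det_one_add_vecMulVec_eq_one _ _ (unipotentCol_mul_unipotentRow c a), ?_⟩
  intro ε hε
  have hpq : ∀ p q, ∑ a : Option (Option ι), ((if p = q then ε (a, p) else 0) +
      unipotentCol c a p * unipotentRow c a q * (ε (a, q) - ε (a, p))) = 0 := by
    intro p q
    have := congrFun hε (Sum.inl (p, q))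
    rw [tangentMatrix_mulVec_inl] at this
    simpa only [adjugate_one_add_vecMulVec _ _ (unipotentCol_mul_unipotentRow c _),
      one_add_vecMulVec_conj_diagonal _ _ (unipotentCol_mul_unipotentRow c _), Pi.zero_apply]
      using this
  have hsum : ∀ a, ∑ i, ε (a, i) = 0 := by
    intro a
    have := congrFun hε (Sum.inr (Sum.inl a))
    rwa [tangentMatrix_mulVec_inr_inl] at this
  have hm : ∀ a, ∑ i, (m i : L) * ε (a, i) = 0 := by
    intro a
    have := congrFun hε (Sum.inr (Sum.inr a))
    rwa [tangentMatrix_mulVec_inr_inr] at this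
  have hconst : ∀ a (v : L), (∀ q, ε (a, q) = v) → v = 0 := by
    intro a v hv
    have := hsum a
    simp only [hv, Finset.sum_const, Finset.card_univ, nsmul_eq_mul] at this
    exact (mul_eq_zero.1 this).resolve_left hN
  have hoff : ∀ p q, p ≠ q → ε (some (some p), q) - ε (some (some p), p) +
      (if p ≠ c ∧ q = c then ε (some none, q) - ε (some none, p) else 0) = 0 := by
    intro p q h
    have := hpq p q
    simp only [Fintype.sum_option, h, if_false, zero_add, unipotentCol, unipotentRow,
      Pi.zero_apply, zero_mul] at this
    rw [Finset.sum_eq_single p (fun i _ hi => by simp [Ne.symm hi]) (by simp),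
      Pi.single_eq_same, if_neg (Ne.symm h)] at this
    by_cases h1 : p = c
    · simpa [h1] using this
    · by_cases h2 : q = c
      · subst h2
        simp only [h1, if_false, Pi.single_eq_same, one_mul] at this
        simp only [ne_eq, h1, not_false_eq_true, and_self, if_true]
        linear_combination this
      · simpa [h1, h2] using this
  have hrow : ∀ p q, ε (some (some p), q) = 0 := by
    intro p
    by_cases hpc : p = c
    · subst hpc
      have h1 : ∀ q, ε (some (some p), q) = ε (some (some p), p) := by
        intro q
        by_cases hq : p = q
        · rw [hq]
        · simpa [sub_eq_zero] using hoff p q hq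
      intro q
      rw [h1]
      exact hconst _ _ h1
    · have h1 : ∀ q, ε (some (some p), q) = ε (some (some p), p) +
          (if q = c then ε (some (some p), c) - ε (some (some p), p) else 0) := by
        intro q
        by_cases hqc : q = c
        · simp [hqc]
        · by_cases hq : p = q
          · subst hq
            simp [hqc]
          · simpa [hqc, sub_eq_zero] using hoff p q hq
      set v := ε (some (some p), p)
      set d := ε (some (some p), c) - v with hd
      have hs := hsum (some (some p))
      have hs' := hm (some (some p))
      simp only [h1, mul_add, Finset.sum_add_distrib, ← Finset.sum_mul, mul_ite, mul_zero,
        Finset.sum_ite_eq', Finset.mem_univ, if_true, Finset.sum_const, Finset.card_univ,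
        nsmul_eq_mul] at hs hs'
      have hv : ((Fintype.card ι : L) * m c - ∑ i, (m i : L)) * v = 0 := by
        linear_combination (m c : L) * hs - hs'
      have hv0 : v = 0 := (mul_eq_zero.1 hv).resolve_left (sub_ne_zero.2 hc)
      have hd0 : d = 0 := by simpa [hv0] using hs
      intro q
      rw [h1, hv0, hd0]
      simp
  have hcol : ∀ q, ε (some none, q) = 0 := by
    have h1 : ∀ q, ε (some none, q) = ε (some none, c) := by
      intro q
      by_cases hq : q = c
      · rw [hq]
      · have := hoff q c hq
        simp only [hrow, hq, ne_eq, not_false_eq_true, and_self, if_true, sub_zero,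
          zero_add] at this
        exact (sub_eq_zero.1 this).symm
    intro q
    rw [h1]
    exact hconst _ _ h1
  have hzero : ∀ q, ε (none, q) = 0 := by
    intro q
    have := hpq q q
    simpa [Fintype.sum_option, hrow, hcol] using this
  funext ⟨a, q⟩
  rcases a with _ | _ | p
  · exact hzero q
  · exact hcol q
  · exact hrow p q

/-- Some maximal minor of `tangentMatrix` is nonzero at a suitable tuple of elements of `SL_n`. -/
theorem exists_tangentMatrix_minor_ne_zero (hκ : Fintype.card κ = Fintype.card ι + 2)
    (hN : (Fintype.card ι : L) ≠ 0) (m : ι → ℤ) (c : ι)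
    (hc : (Fintype.card ι : L) * m c ≠ ∑ i, (m i : L)) :
    ∃ (e : κ × ι → (ι × ι) ⊕ (κ ⊕ κ)) (H : κ → Matrix ι ι L), (∀ a, (H a).det = 1) ∧
      ((tangentMatrix m H).submatrix e id).det ≠ 0 := by
  obtain ⟨H, hdet, hH⟩ := exists_tangentMatrix_injective hN m c hc
  let φ : κ ≃ Option (Option ι) := Fintype.equivOfCardEq (by simp [hκ])
  suffices h : ∃ e : κ × ι → (ι × ι) ⊕ (κ ⊕ κ),
      ((tangentMatrix m (fun a => H (φ a))).submatrix e id).det ≠ 0 by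
    obtain ⟨e, he⟩ := h
    exact ⟨e, fun a => H (φ a), fun a => hdet _, he⟩
  apply Matrix.exists_det_submatrix_ne_zero
  intro ε hε
  have h0 : (fun s : Option (Option ι) × ι => ε (φ.symm s.1, s.2)) = 0 := by
    apply hH
    funext r
    rcases r with ⟨p, q⟩ | b | b
    · have := congrFun hε (Sum.inl (p, q))
      rw [tangentMatrix_mulVec_inl] at this ⊢
      rw [← φ.sum_comp]
      simpa using this
    · have := congrFun hε (Sum.inr (Sum.inl (φ.symm b)))
      rw [tangentMatrix_mulVec_inr_inl] at this ⊢
      exact this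
    · have := congrFun hε (Sum.inr (Sum.inr (φ.symm b)))
      rw [tangentMatrix_mulVec_inr_inr] at this ⊢
      exact this
  funext ⟨a, i⟩
  simpa using congrFun h0 (φ a, i)

end Tangent

section TorusWord

variable {ι : Type*} [Fintype ι] [DecidableEq ι]

/-- The partial products of the word `g₀ diag(t₀) g₁ diag(t₁) ⋯`. -/
def torusWord {R : Type*} [CommRing R] (g : ℕ → Matrix ι ι R) (t : ℕ → ι → R) :
    ℕ → Matrix ι ι R
  | 0 => 1
  | a + 1 => torusWord g t a * g a * Matrix.diagonal (t a)

theorem torusWord_congr {R : Type*} [CommRing R] {g g' : ℕ → Matrix ι ι R} {t t' : ℕ → ι → R}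
    {a : ℕ} (hg : ∀ b < a, g b = g' b) (ht : ∀ b < a, t b = t' b) :
    torusWord g t a = torusWord g' t' a := by
  induction a with
  | zero => rfl
  | succ a ih =>
    rw [torusWord, torusWord, ih (fun b hb => hg b (hb.trans a.lt_succ_self))
      (fun b hb => ht b (hb.trans a.lt_succ_self)), hg a a.lt_succ_self, ht a a.lt_succ_self]

theorem torusWord_map {R S : Type*} [CommRing R] [CommRing S] (φ : R →+* S)
    (g : ℕ → Matrix ι ι R) (t : ℕ → ι → R) (a : ℕ) :
    (torusWord g t a).map φ =
      torusWord (fun b => (g b).map φ) (fun b i => φ (t b i)) a := by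
  induction a with
  | zero => simp [torusWord]
  | succ a ih =>
    rw [torusWord, torusWord, ← ih, Matrix.map_mul, Matrix.map_mul,
      Matrix.diagonal_map (map_zero φ)]

theorem det_torusWord {R : Type*} [CommRing R] (g : ℕ → Matrix ι ι R) (t : ℕ → ι → R)
    (hg : ∀ a, (g a).det = 1) (ht : ∀ a, ∏ i, t a i = 1) (a : ℕ) :
    (torusWord g t a).det = 1 := by
  induction a with
  | zero => simp [torusWord]
  | succ a ih => rw [torusWord, Matrix.det_mul, Matrix.det_mul, ih, hg, Matrix.det_diagonal, ht,
      one_mul, one_mul]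

variable {σ L : Type*} [Field L]

theorem totalDegree_torusWord_le (g : ℕ → Matrix ι ι L) (t : ℕ → ι → MvPolynomial σ L)
    (ht : ∀ a i, (t a i).totalDegree ≤ 1) (a : ℕ) (i j : ι) :
    (torusWord (fun b => (g b).map MvPolynomial.C) t a i j).totalDegree ≤ a := by
  induction a generalizing i j with
  | zero =>
    rw [torusWord, Matrix.one_apply]
    split <;> simp
  | succ a ih =>
    rw [torusWord, Matrix.mul_diagonal]
    refine (MvPolynomial.totalDegree_mul _ _).trans (Nat.add_le_add ?_ (ht a j))
    rw [Matrix.mul_apply]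
    refine MvPolynomial.totalDegree_finsetSum_le fun k _ => ?_
    refine (MvPolynomial.totalDegree_mul _ _).trans ?_
    rw [Matrix.map_apply, MvPolynomial.totalDegree_C, add_zero]
    exact ih i k

variable [Fintype σ]

omit [DecidableEq ι] in
theorem dirDeriv_matrix_mul (z w : σ → L) (A B : Matrix ι ι (MvPolynomial σ L)) :
    (A * B).map (dirDeriv z w) = A.map (dirDeriv z w) * B.map (MvPolynomial.eval z) +
      A.map (MvPolynomial.eval z) * B.map (dirDeriv z w) := by
  ext i j
  simp only [Matrix.map_apply, Matrix.mul_apply, Matrix.add_apply, dirDeriv_sum, dirDeriv_mul,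
    Finset.sum_add_distrib]

theorem dirDeriv_prod_pow {κ : Type*} (z w : σ → L) (s : Finset κ) (f : κ → MvPolynomial σ L)
    (ε : κ → L) (hf : ∀ i, dirDeriv z w (f i) = MvPolynomial.eval z (f i) * ε i) (k : κ → ℕ) :
    dirDeriv z w (∏ i ∈ s, f i ^ k i) =
      MvPolynomial.eval z (∏ i ∈ s, f i ^ k i) * ∑ i ∈ s, (k i : L) * ε i := by
  classical
  have hpow : ∀ i (n : ℕ), dirDeriv z w (f i ^ n) =
      MvPolynomial.eval z (f i ^ n) * ((n : L) * ε i) := by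
    intro i n
    induction n with
    | zero => simp [dirDeriv_one]
    | succ n ih =>
      rw [pow_succ, dirDeriv_mul, ih, hf, map_mul]
      push_cast
      ring
  induction s using Finset.induction_on with
  | empty => simp [dirDeriv_one]
  | insert i s hi ih =>
    rw [Finset.prod_insert hi, Finset.sum_insert hi, dirDeriv_mul, ih, hpow, map_mul]
    ring

/-- The logarithmic derivative of a word in torus elements. -/
theorem dirDeriv_torusWord (z w : σ → L) (g : ℕ → Matrix ι ι L) (T : ℕ → ι → MvPolynomial σ L)
    (t ε : ℕ → ι → L) (hg : ∀ a, (g a).det = 1) (ht : ∀ a, ∏ i, t a i = 1)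
    (hT : ∀ a i, MvPolynomial.eval z (T a i) = t a i)
    (hε : ∀ a i, dirDeriv z w (T a i) = t a i * ε a i) (a : ℕ) :
    (torusWord (fun b => (g b).map MvPolynomial.C) T a).map (dirDeriv z w) =
      (∑ b ∈ Finset.range a, torusWord g t b * g b * Matrix.diagonal (ε b) *
        (torusWord g t b * g b).adjugate) * torusWord g t a := by
  have hev : ∀ a, (torusWord (fun b => (g b).map MvPolynomial.C) T a).map (MvPolynomial.eval z) =
      torusWord g t a := by
    intro a
    rw [torusWord_map]
    congr
    · funext b
      ext i j
      simp
    · funext b i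
      exact hT b i
  have hzero : ∀ b, ((g b).map (MvPolynomial.C (σ := σ))).map (dirDeriv z w) = 0 := by
    intro b
    ext i j
    simp [dirDeriv_C]
  have hgev : ∀ b, ((g b).map (MvPolynomial.C (σ := σ))).map (MvPolynomial.eval z) = g b := by
    intro b
    ext i j
    simp
  induction a with
  | zero =>
    ext i j
    rw [torusWord, Matrix.map_apply, Matrix.one_apply]
    split
    · simp [dirDeriv_one]
    · simp [dirDeriv]
  | succ a ih =>
    have hdiag : (Matrix.diagonal (T a)).map (dirDeriv z w) =
        Matrix.diagonal (ε a) * Matrix.diagonal (t a) := by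
      ext i j
      rw [Matrix.diagonal_mul_diagonal, Matrix.map_apply, Matrix.diagonal_apply,
        Matrix.diagonal_apply]
      split
      · rw [hε, mul_comm]
      · simp [dirDeriv]
    have hdiag' : (Matrix.diagonal (T a)).map (MvPolynomial.eval z) =
        Matrix.diagonal (t a) := by
      rw [Matrix.diagonal_map (map_zero _)]
      congr
      funext i
      exact hT a i
    rw [torusWord, dirDeriv_matrix_mul, dirDeriv_matrix_mul, ih, hdiag, hdiag', hzero,
      Matrix.map_mul, hev, hgev, mul_zero, add_zero, Finset.sum_range_succ, add_mul]
    rw [torusWord]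
    have hH : (torusWord g t a * g a).adjugate * (torusWord g t a * g a) = 1 := by
      rw [Matrix.adjugate_mul, Matrix.det_mul, det_torusWord g t hg ht, hg, one_mul, one_smul]
    congr 1
    · simp only [mul_assoc]
    · rw [← mul_assoc _ (torusWord g t a * g a), mul_assoc _ _ (torusWord g t a * g a), hH,
        mul_one, ← mul_assoc]

end TorusWord

section Fiber

variable {ι L : Type*} [Fintype ι] [DecidableEq ι] [Field L]

/-- The equations for a word in torus elements to have the value `P`: the rows are indexed as
those of `tangentMatrix`. -/
noncomputable def wordEquation {k : ℕ} (m : ι → ℤ) (g : Fin (k + 1) → Matrix ι ι L)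
    (P : Matrix ι ι L) :
    (ι × ι) ⊕ (Fin (k + 1) ⊕ Fin (k + 1)) → MvPolynomial (Fin (k + 1) × ι) L
  | Sum.inl (p, q) => ((torusWord (fun a => (g (Fin.ofNat (k + 1) a)).map MvPolynomial.C)
      (fun a i => MvPolynomial.X (Fin.ofNat (k + 1) a, i)) (k + 1) *
        P.adjugate.map MvPolynomial.C :
          Matrix ι ι (MvPolynomial (Fin (k + 1) × ι) L)) p q : MvPolynomial _ L) -
    MvPolynomial.C ((1 : Matrix ι ι L) p q)
  | Sum.inr (Sum.inl b) => ∏ i, MvPolynomial.X (b, i) ^ 1 - 1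
  | Sum.inr (Sum.inr b) => ∏ i, MvPolynomial.X (b, i) ^ (m i).toNat -
      ∏ i, MvPolynomial.X (b, i) ^ (-m i).toNat

theorem totalDegree_wordEquation_le {k M : ℕ} (m : ι → ℤ) (hm : ∀ i, (m i).natAbs ≤ M)
    (g : Fin (k + 1) → Matrix ι ι L) (P : Matrix ι ι L)
    (r : (ι × ι) ⊕ (Fin (k + 1) ⊕ Fin (k + 1))) :
    (wordEquation m g P r).totalDegree ≤ (k + 1) + Fintype.card ι * (M + 1) := by
  have hprod : ∀ (b : Fin (k + 1)) (e : ι → ℕ), (∀ i, e i ≤ M + 1) →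
      (∏ i, (MvPolynomial.X (b, i) : MvPolynomial (Fin (k + 1) × ι) L) ^ e i).totalDegree ≤
        Fintype.card ι * (M + 1) := by
    intro b e he
    refine (MvPolynomial.totalDegree_finsetProd _ _).trans ?_
    refine (Finset.sum_le_card_nsmul _ _ (M + 1) fun i _ => ?_).trans (by simp)
    rw [MvPolynomial.totalDegree_X_pow]
    exact he i
  rcases r with ⟨p, q⟩ | b | b
  · refine (MvPolynomial.totalDegree_sub _ _).trans (max_le ?_ (by simp))
    refine le_trans ?_ (Nat.le_add_right _ _)
    rw [Matrix.mul_apply]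
    refine MvPolynomial.totalDegree_finsetSum_le fun j _ => ?_
    refine (MvPolynomial.totalDegree_mul _ _).trans ?_
    rw [Matrix.map_apply, MvPolynomial.totalDegree_C, add_zero]
    exact totalDegree_torusWord_le _ _ (fun a i => (MvPolynomial.totalDegree_X _).le) _ _ _
  · refine (MvPolynomial.totalDegree_sub _ _).trans (max_le ?_ (by simp))
    exact (hprod b _ fun i => by omega).trans (Nat.le_add_left _ _)
  · refine (MvPolynomial.totalDegree_sub _ _).trans (max_le ?_ ?_)
    · exact (hprod b _ fun i => by have := hm i; omega).trans (Nat.le_add_left _ _)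
    · exact (hprod b _ fun i => by have := hm i; omega).trans (Nat.le_add_left _ _)

omit [DecidableEq ι] in
theorem prod_zpow_eq_one_iff (m : ι → ℤ) (d : ι → L) (hd : ∀ i, d i ≠ 0) :
    ∏ i, d i ^ m i = 1 ↔ ∏ i, d i ^ (m i).toNat = ∏ i, d i ^ (-m i).toNat := by
  have hne : ∏ i, d i ^ (-m i).toNat ≠ 0 :=
    Finset.prod_ne_zero_iff.2 fun i _ => pow_ne_zero _ (hd i)
  rw [← div_eq_one_iff_eq hne, ← Finset.prod_div_distrib]
  refine Eq.congr (Finset.prod_congr rfl fun i _ => ?_) rfl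
  rw [← zpow_natCast, ← zpow_natCast, ← zpow_sub₀ (hd i)]
  congr 1
  omega

/-- The number of tuples of elements of the group `{∏ d_i = ∏ d_i ^ m_i = 1}` at which a word
takes a given value without being degenerate is bounded. -/
theorem card_nondegenerate_word_fiber_le [Infinite L] {k M : ℕ} (m : ι → ℤ)
    (hm : ∀ i, (m i).natAbs ≤ M) (g : Fin (k + 1) → Matrix ι ι L) (hg : ∀ a, (g a).det = 1)
    (P : Matrix ι ι L) (hP : P.det = 1)
    (e : Fin (k + 1) × ι → (ι × ι) ⊕ (Fin (k + 1) ⊕ Fin (k + 1)))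
    (Z : Finset (Fin (k + 1) × ι → L)) (h1 : ∀ z ∈ Z, ∀ a, ∏ i, z (a, i) = 1)
    (h2 : ∀ z ∈ Z, ∀ a, ∏ i, z (a, i) ^ m i = 1)
    (h3 : ∀ z ∈ Z, torusWord (fun a => g (Fin.ofNat (k + 1) a))
      (fun a i => z (Fin.ofNat (k + 1) a, i)) (k + 1) = P)
    (h4 : ∀ z ∈ Z, ((tangentMatrix m fun a : Fin (k + 1) =>
      torusWord (fun a => g (Fin.ofNat (k + 1) a)) (fun a i => z (Fin.ofNat (k + 1) a, i)) a *
        g a).submatrix e id).det ≠ 0) :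
    Z.card ≤ ((k + 1) * Fintype.card ι * ((k + 1) + Fintype.card ι * (M + 1)) + 2) ^
      ((k + 1) * Fintype.card ι) := by
  have hcard : Fintype.card (Fin (k + 1) × ι) = (k + 1) * Fintype.card ι := by simp
  rw [← hcard]
  have hz0 : ∀ z ∈ Z, ∀ s, z s ≠ 0 := by
    intro z hz s hs
    have := h1 z hz s.1
    rw [Finset.prod_eq_zero (Finset.mem_univ s.2) hs] at this
    exact zero_ne_one this
  have hadj : P * P.adjugate = 1 := by rw [Matrix.mul_adjugate, hP, one_smul]
  refine card_nondegenerate_zeros_le _ (fun j => wordEquation m g P (e j))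
    (fun j => totalDegree_wordEquation_le m hm g P (e j)) Z ?_ ?_
  · intro z hz j
    have key : ∀ r, MvPolynomial.eval z (wordEquation m g P r) = 0 := by
      rintro (⟨p, q⟩ | b | b)
      · rw [wordEquation, map_sub, MvPolynomial.eval_C,
          ← Matrix.map_apply (f := MvPolynomial.eval z), Matrix.map_mul, torusWord_map]
        have := h3 z hz
        simp only [MvPolynomial.eval_X, Matrix.map_map]
        rw [sub_eq_zero]
        convert congrFun (congrFun hadj p) q
        · rw [← this]
          congr
          funext b
          ext i j
          simp
        · ext i j
          simp
      · simp [wordEquation, h1 z hz b]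
      · have := (prod_zpow_eq_one_iff m (fun i => z (b, i)) fun i => hz0 z hz _).1 (h2 z hz b)
        simp [wordEquation, this]
    exact key (e j)
  · intro z hz w hw
    let ε : Fin (k + 1) × ι → L := fun s => w s / z s
    have hwε : ∀ s, w s = z s * ε s := fun s => (mul_div_cancel₀ _ (hz0 z hz s)).symm
    have hX : ∀ s, dirDeriv z w (MvPolynomial.X s) =
        MvPolynomial.eval z (MvPolynomial.X s) * ε s := by
      intro s
      rw [dirDeriv_X, MvPolynomial.eval_X, hwε]
    let H : Fin (k + 1) → Matrix ι ι L := fun a =>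
      torusWord (fun a => g (Fin.ofNat (k + 1) a)) (fun a i => z (Fin.ofNat (k + 1) a, i)) a * g a
    have key : ∀ r, dirDeriv z w (wordEquation m g P r) = 0 →
        (tangentMatrix m H).mulVec ε r = 0 := by
      rintro (⟨p, q⟩ | b | b) hr
      · rw [tangentMatrix_mulVec_inl]
        rw [wordEquation, dirDeriv_sub, dirDeriv_C, sub_zero,
          ← Matrix.map_apply (f := dirDeriv z w), dirDeriv_matrix_mul,
          dirDeriv_torusWord z w _ _ (fun a i => z (Fin.ofNat (k + 1) a, i))
            (fun a i => ε (Fin.ofNat (k + 1) a, i)) (fun a => hg _) (fun a => h1 z hz _)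
            (fun a i => MvPolynomial.eval_X _)
            (fun a i => by rw [hX, MvPolynomial.eval_X]), h3 z hz] at hr
        have e1 : (P.adjugate.map (MvPolynomial.C (σ := Fin (k + 1) × ι))).map
            (MvPolynomial.eval z) = P.adjugate := by
          ext i j
          simp
        have e2 : (P.adjugate.map (MvPolynomial.C (σ := Fin (k + 1) × ι))).map
            (dirDeriv z w) = 0 := by
          ext i j
          simp [dirDeriv_C]
        rw [e1, e2, mul_zero, add_zero, mul_assoc, hadj, mul_one, Finset.sum_range] at hr
        simp only [Fin.ofNat_val_eq_self, Matrix.sum_apply] at hr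
        exact hr
      · rw [tangentMatrix_mulVec_inr_inl]
        rw [wordEquation, dirDeriv_sub, dirDeriv_one, sub_zero,
          dirDeriv_prod_pow z w _ _ (fun i => ε (b, i)) (fun i => hX _)] at hr
        simpa [h1 z hz b] using hr
      · rw [tangentMatrix_mulVec_inr_inr]
        have := (prod_zpow_eq_one_iff m (fun i => z (b, i)) fun i => hz0 z hz _).1 (h2 z hz b)
        rw [wordEquation, dirDeriv_sub,
          dirDeriv_prod_pow z w _ _ (fun i => ε (b, i)) (fun i => hX _),
          dirDeriv_prod_pow z w _ _ (fun i => ε (b, i)) (fun i => hX _)] at hr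
        simp only [map_prod, map_pow, MvPolynomial.eval_X] at hr
        rw [this, ← mul_sub, ← Finset.sum_sub_distrib] at hr
        have hne : ∏ i, z (b, i) ^ (-m i).toNat ≠ 0 :=
          Finset.prod_ne_zero_iff.2 fun i _ => pow_ne_zero _ (hz0 z hz _)
        rw [← (mul_eq_zero.1 hr).resolve_left hne]
        refine Finset.sum_congr rfl fun i _ => ?_
        rw [← sub_mul]
        congr 1
        have : m i = ((m i).toNat : ℤ) - ((-m i).toNat : ℤ) := by omega
        exact_mod_cast congrArg (Int.cast : ℤ → L) this
    have hε : ε = 0 := by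
      refine Matrix.eq_zero_of_mulVec_eq_zero (h4 z hz) ?_
      funext j
      exact key (e j) (hw j)
    funext s
    rw [hwε, hε]
    simp

end Fiber

section Escape

variable {ι L : Type*} [Fintype ι] [DecidableEq ι] [Field L]

theorem adjugate_entry_mem_affineFun_pow (i j : ι) :
    (fun g : Matrix ι ι L => g.adjugate i j) ∈ affineFun ι L ^ Fintype.card ι := by
  have h := det_mem_affineFun_pow (ι := ι) (L := L) 1
    (fun g => g.updateRow j (Pi.single i 1)) fun r s => by
      rw [pow_one]
      by_cases hr : r = j
      · subst hr
        simpa using const_mem_affineFun_pow (ι := ι) ((Pi.single i 1 : ι → L) s) 1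
      · simpa [hr] using entry_mem_affineFun (L := L) r s
  simpa only [one_mul, Matrix.adjugate_apply] using h

/-- A minor of `tangentMatrix` is a polynomial function of each of the group elements. -/
theorem tangentMatrix_minor_mem_affineFun_pow {κ : Type*} [Fintype κ] [DecidableEq κ] (m : ι → ℤ)
    (e : κ × ι → (ι × ι) ⊕ (κ ⊕ κ)) (H : κ → Matrix ι ι L) (b : κ) (P : Matrix ι ι L) :
    (fun g => ((tangentMatrix m (Function.update H b (P * g))).submatrix e id).det) ∈
      affineFun ι L ^ ((Fintype.card ι + 1) * (Fintype.card κ * Fintype.card ι)) := by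
  rw [← Fintype.card_prod]
  refine det_mem_affineFun_pow _ _ fun r s => ?_
  simp only [Matrix.submatrix_apply, id]
  rcases e r with ⟨p, q⟩ | b' | b'
  · simp only [tangentMatrix, Matrix.of_apply]
    by_cases hs : s.1 = b
    · subst hs
      simp only [Function.update_self]
      have h : (fun g : Matrix ι ι L => g p s.2 * g.adjugate s.2 q) ∈
          affineFun ι L ^ (Fintype.card ι + 1) := by
        rw [pow_succ']
        exact Submodule.mul_mem_mul (entry_mem_affineFun p s.2)
          (adjugate_entry_mem_affineFun_pow s.2 q)
      simpa using comp_mul_mul_mem_affineFun_pow P 1 h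
    · simp only [Function.update_of_ne hs]
      exact const_mem_affineFun_pow _ _
  · exact const_mem_affineFun_pow (if b' = s.1 then 1 else 0) _
  · exact const_mem_affineFun_pow (if b' = s.1 then (m s.2 : L) else 0) _

/-- Given arbitrary torus elements, one may choose the other letters of a word in a detecting set
so that the word is nondegenerate at those torus elements. -/
theorem exists_letters_tangentMatrix_minor_ne_zero {G : Type*} {k : ℕ} (m : ι → ℤ)
    (e : Fin (k + 1) × ι → (ι × ι) ⊕ (Fin (k + 1) ⊕ Fin (k + 1)))
    (H₀ : Fin (k + 1) → Matrix ι ι L) (hH₀ : ∀ a, (H₀ a).det = 1)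
    (hminor : ((tangentMatrix m H₀).submatrix e id).det ≠ 0)
    (ρ : G → Matrix ι ι L) (hρ : ∀ x, (ρ x).det = 1) (X : Finset G)
    (hX : ∀ f ∈ affineFun ι L ^ ((Fintype.card ι + 1) * ((k + 1) * Fintype.card ι)),
      (∀ x ∈ X, f (ρ x) = 0) → ∀ g : Matrix ι ι L, g.det = 1 → f g = 0)
    (t : Fin (k + 1) → ι → L) (ht : ∀ a, ∏ i, t a i = 1) :
    ∃ x : Fin (k + 1) → G, (∀ a, x a ∈ X) ∧
      ((tangentMatrix m fun a : Fin (k + 1) =>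
        torusWord (fun a => ρ (x (Fin.ofNat (k + 1) a))) (fun a i => t (Fin.ofNat (k + 1) a) i) a *
          ρ (x a)).submatrix e id).det ≠ 0 := by
  have step : ∀ b ≤ k + 1, ∃ (x : Fin (k + 1) → G) (H : Fin (k + 1) → Matrix ι ι L),
      (∀ a, x a ∈ X) ∧ (∀ a, (H a).det = 1) ∧
      (∀ a : Fin (k + 1), (a : ℕ) < b → H a =
        torusWord (fun a => ρ (x (Fin.ofNat (k + 1) a))) (fun a i => t (Fin.ofNat (k + 1) a) i) a *
          ρ (x a)) ∧ ((tangentMatrix m H).submatrix e id).det ≠ 0 := by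
    intro b
    induction b with
    | zero =>
      intro _
      have hne : X.Nonempty := by
        by_contra hX0
        rw [Finset.not_nonempty_iff_eq_empty] at hX0
        have := hX (fun _ => 1) (const_mem_affineFun_pow 1 _) (by simp [hX0]) 1 Matrix.det_one
        exact one_ne_zero this
      obtain ⟨x, hx⟩ := hne
      exact ⟨fun _ => x, H₀, fun _ => hx, hH₀, by simp, hminor⟩
    | succ b ih =>
      intro hb
      obtain ⟨x, H, hxX, hdet, hH, hne⟩ := ih (by omega)
      let β : Fin (k + 1) := ⟨b, by omega⟩
      let P := torusWord (fun a => ρ (x (Fin.ofNat (k + 1) a)))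
        (fun a i => t (Fin.ofNat (k + 1) a) i) b
      have hP : P.det = 1 := det_torusWord _ _ (fun a => hρ _) (fun a => ht _) b
      have hPP : P * P.adjugate = 1 := by rw [Matrix.mul_adjugate, hP, one_smul]
      have hPadj : P.adjugate.det = 1 := by
        have := congrArg Matrix.det hPP
        rwa [Matrix.det_mul, hP, one_mul, Matrix.det_one] at this
      have hmem := tangentMatrix_minor_mem_affineFun_pow m e H β P
      rw [Fintype.card_fin] at hmem
      obtain ⟨y, hy, hyne⟩ : ∃ y ∈ X,
          ((tangentMatrix m (Function.update H β (P * ρ y))).submatrix e id).det ≠ 0 := by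
        by_contra! hall
        have := hX _ hmem hall (P.adjugate * H β) (by rw [Matrix.det_mul, hPadj, hdet, one_mul])
        simp only [← mul_assoc, hPP, one_mul, Function.update_eq_self] at this
        exact hne this
      have hword : ∀ a ≤ b, torusWord (fun a => ρ (Function.update x β y (Fin.ofNat (k + 1) a)))
          (fun a i => t (Fin.ofNat (k + 1) a) i) a =
          torusWord (fun a => ρ (x (Fin.ofNat (k + 1) a)))
            (fun a i => t (Fin.ofNat (k + 1) a) i) a := by
        intro a ha
        refine torusWord_congr (fun c hc => ?_) fun _ _ => rfl
        rw [Function.update_of_ne]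
        intro h
        have := congrArg Fin.val h
        simp only [Fin.ofNat, β] at this
        rw [Nat.mod_eq_of_lt (by omega)] at this
        omega
      refine ⟨Function.update x β y, Function.update H β (P * ρ y), ?_, ?_, ?_, hyne⟩
      · intro a
        by_cases ha : a = β
        · subst ha
          simpa using hy
        · simpa [ha] using hxX a
      · intro a
        by_cases ha : a = β
        · subst ha
          simp [hP, hρ]
        · simpa [ha] using hdet a
      · intro a ha
        rw [hword a (by omega)]
        by_cases haβ : a = β
        · subst haβ
          simp [P, β]
        · have : (a : ℕ) ≠ b := fun h => haβ (Fin.ext h)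
          rw [Function.update_of_ne haβ, Function.update_of_ne haβ]
          exact hH a (by omega)
  obtain ⟨x, H, hxX, -, hH, hne⟩ := step (k + 1) le_rfl
  refine ⟨x, hxX, ?_⟩
  rwa [← funext fun a => hH a a.isLt]

end Escape

section Counting

/-- The partial products of the word `x₀ s₀ x₁ s₁ ⋯`. -/
def alternatingWord {G : Type*} [Group G] (x s : ℕ → G) : ℕ → G
  | 0 => 1
  | a + 1 => alternatingWord x s a * x a * s a

theorem prodSet_one {G : Type*} [Group G] (A : Set G) : A ⊆ prodSet A 1 := by
  rw [prodSet, pow_one]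
  exact fun x hx => Or.inl (Or.inl hx)

theorem mul_mem_prodSet {G : Type*} [Group G] {A : Set G} {a b : ℕ} {x y : G}
    (hx : x ∈ prodSet A a) (hy : y ∈ prodSet A b) : x * y ∈ prodSet A (a + b) := by
  rw [prodSet, pow_add]
  exact Set.mul_mem_mul hx hy

theorem alternatingWord_mem_prodSet {G : Type*} [Group G] {A : Set G} {d : ℕ} {x s : ℕ → G}
    (hx : ∀ a, x a ∈ prodSet A d) (hs : ∀ a, s a ∈ A) (a : ℕ) :
    alternatingWord x s a ∈ prodSet A (a * (d + 1)) := by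
  induction a with
  | zero => simp [alternatingWord, prodSet]
  | succ a ih =>
    rw [alternatingWord, add_mul, one_mul, ← add_assoc]
    exact mul_mem_prodSet (mul_mem_prodSet ih (hx a)) (prodSet_one A (hs a))

variable {ι L : Type*} [Fintype ι] [DecidableEq ι] [Field L]

theorem map_alternatingWord {G : Type*} [Group G] (ρ : G →* Matrix.SpecialLinearGroup ι L)
    (x s : ℕ → G) (d : G → ι → L) (hd : ∀ a, (ρ (s a)).1 = Matrix.diagonal (d (s a))) (a : ℕ) :
    (ρ (alternatingWord x s a)).1 =
      torusWord (fun a => (ρ (x a)).1) (fun a => d (s a)) a := by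
  induction a with
  | zero => simp [alternatingWord, torusWord]
  | succ a ih =>
    rw [alternatingWord, torusWord, map_mul, map_mul, Matrix.SpecialLinearGroup.coe_mul,
      Matrix.SpecialLinearGroup.coe_mul, ih, hd]

/-- Counting words: a set of torus elements killed by the characters with exponents `1` and `m` is
small compared with the set of values of words in it and a detecting set. -/
theorem card_pow_le_of_detecting [Infinite L] {G : Type*} [Group G] {k M : ℕ}
    (hk : k + 1 = Fintype.card ι + 2)
    (hN : (Fintype.card ι : L) ≠ 0) (m : ι → ℤ) (hm : ∀ i, (m i).natAbs ≤ M) (c : ι)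
    (hc : (Fintype.card ι : L) * m c ≠ ∑ i, (m i : L))
    (ρ : G →* Matrix.SpecialLinearGroup ι L) (hρ : Function.Injective ρ) (A : Set G) {r : ℕ}
    (X : Finset G) (hXA : ↑X ⊆ prodSet A r)
    (hX : ∀ f ∈ affineFun ι L ^ ((Fintype.card ι + 1) * ((k + 1) * Fintype.card ι)),
      (∀ x ∈ X, f (ρ x).1 = 0) → ∀ g : Matrix.SpecialLinearGroup ι L, f g.1 = 0)
    (S : Finset G) (hSA : ↑S ⊆ A) (d : G → ι → L)
    (hd : ∀ s ∈ S, (ρ s).1 = Matrix.diagonal (d s)) (h1 : ∀ s ∈ S, ∏ i, d s i = 1)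
    (h2 : ∀ s ∈ S, ∏ i, d s i ^ m i = 1) (W : Finset G)
    (hW : ∀ w ∈ prodSet A ((k + 1) * (r + 1)), w ∈ W) :
    S.card ^ (k + 1) ≤
      ((k + 1) * Fintype.card ι * ((k + 1) + Fintype.card ι * (M + 1)) + 2) ^
        ((k + 1) * Fintype.card ι) * (X.card ^ (k + 1) * W.card) := by
  classical
  obtain ⟨e, H₀, hH₀, hminor⟩ := exists_tangentMatrix_minor_ne_zero (κ := Fin (k + 1))
    (by rw [Fintype.card_fin, hk]) hN m c hc
  have hex : ∀ s : Fin (k + 1) → S, ∃ x : Fin (k + 1) → G, (∀ a, x a ∈ X) ∧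
      ((tangentMatrix m fun a : Fin (k + 1) =>
        torusWord (fun a => (ρ (x (Fin.ofNat (k + 1) a))).1)
          (fun a i => d (s (Fin.ofNat (k + 1) a)) i) a * (ρ (x a)).1).submatrix e id).det ≠ 0 :=
    fun s => exists_letters_tangentMatrix_minor_ne_zero m e H₀ hH₀ hminor (fun x => (ρ x).1)
      (fun x => (ρ x).2) X (fun f hf hfX g hg => hX f hf hfX ⟨g, hg⟩)
      (fun a i => d (s a) i) fun a => h1 _ (s a).2
  choose x hxX hx using hex
  let word : (Fin (k + 1) → S) → G := fun s =>
    alternatingWord (fun a => x s (Fin.ofNat (k + 1) a)) (fun a => s (Fin.ofNat (k + 1) a)) (k + 1)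
  have hcard : (Finset.univ : Finset (Fin (k + 1) → S)).card = S.card ^ (k + 1) := by simp
  have hcard' : (Fintype.piFinset (fun _ : Fin (k + 1) => X) ×ˢ W).card =
      X.card ^ (k + 1) * W.card := by simp [Finset.card_product]
  rw [← hcard, ← hcard']
  refine Finset.card_le_mul_card_image_of_maps_to (f := fun s => (x s, word s)) ?_ _ ?_
  · intro s _
    rw [Finset.mem_product, Fintype.mem_piFinset]
    exact ⟨hxX s, hW _ (alternatingWord_mem_prodSet (fun a => hXA (hxX s _))
      (fun a => hSA (s _).2) _)⟩
  · rintro ⟨y, w⟩ -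
    let coord : (Fin (k + 1) → S) → Fin (k + 1) × ι → L := fun s r => d (s r.1) r.2
    have hinj : Function.Injective coord := by
      intro s s' h
      funext a
      refine Subtype.ext (hρ (Subtype.ext ?_))
      rw [hd _ (s a).2, hd _ (s' a).2]
      congr 1
      funext i
      exact congrFun h (a, i)
    rw [← Finset.card_image_of_injective _ hinj]
    refine card_nondegenerate_word_fiber_le m hm (fun a => (ρ (y a)).1) (fun a => (ρ (y a)).2)
      (ρ w).1 (ρ w).2 e _ ?_ ?_ ?_ ?_
    all_goals
      intro z hz
      obtain ⟨s, hs, rfl⟩ := Finset.mem_image.1 hz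
      obtain ⟨rfl, rfl⟩ := Prod.mk.inj (Finset.mem_filter.1 hs).2
    · exact fun a => h1 _ (s a).2
    · exact fun a => h2 _ (s a).2
    · exact (map_alternatingWord ρ _ _ d (fun a => hd _ (s _).2) _).symm
    · exact hx s

end Counting

section Exponents

variable {ι L : Type*} [Fintype ι] [Field L]

/-- In characteristic `p`, exponents of a multiplicative relation may be divided by `p` until one
of them is prime to `p`. -/
theorem exists_exponents_not_dvd (p : ℕ) [Fact p.Prime] [CharP L p] (i₀ i₁ : ι) (B : ℕ)
    (u : ι → ℤ) (hu : ∀ i, (u i).natAbs ≤ B) (h0 : u i₀ = 0) (h1 : u i₁ ≠ 0) :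
    ∃ v : ι → ℤ, (∀ i, (v i).natAbs ≤ B) ∧ v i₀ = 0 ∧ (∃ i, ((v i : ℤ) : L) ≠ 0) ∧
      ∀ d : ι → L, ∏ i, d i ^ u i = 1 → ∏ i, d i ^ v i = 1 := by
  have hp : p.Prime := Fact.out
  induction hs : (u i₁).natAbs using Nat.strong_induction_on generalizing u with
  | _ s ih =>
    by_cases hdvd : ∃ i, ((u i : ℤ) : L) ≠ 0
    · exact ⟨u, hu, h0, hdvd, fun _ h => h⟩
    · push Not at hdvd
      have hdvd' : ∀ i, ∃ v, u i = p * v := fun i => (CharP.intCast_eq_zero_iff L p _).1 (hdvd i)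
      choose v hv using hdvd'
      have habs : ∀ i, (u i).natAbs = p * (v i).natAbs := fun i => by
        rw [hv, Int.natAbs_mul, Int.natAbs_natCast]
      have hv0 : v i₁ ≠ 0 := fun h => h1 (by rw [hv, h, mul_zero])
      obtain ⟨v', hB, hz, hne, himp⟩ := ih (v i₁).natAbs
        (by
          rw [← hs, habs]
          exact lt_mul_of_one_lt_left (Int.natAbs_pos.2 hv0) hp.one_lt) v
        (fun i => (Nat.le_mul_of_pos_left _ hp.pos).trans ((habs i).symm.le.trans (hu i)))
        (by
          have := hv i₀
          rw [h0] at this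
          exact (mul_eq_zero.1 this.symm).resolve_left (by exact_mod_cast hp.ne_zero)) hv0 rfl
      refine ⟨v', hB, hz, hne, fun d hd => himp d ?_⟩
      have hpow : (∏ i, d i ^ v i) ^ p = 1 := by
        rw [← hd, ← Finset.prod_pow]
        refine Finset.prod_congr rfl fun i _ => ?_
        rw [hv, mul_comm, zpow_mul, zpow_natCast]
      apply frobenius_inj L p
      rw [frobenius_def, hpow, map_one]

/-- A non-constant relation among the entries of diagonal matrices of determinant one has a
consequence which remains nonscalar modulo the characteristic. -/
theorem exists_exponents_card_mul_ne_sum (p : ℕ) [Fact p.Prime] [CharP L p]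
    (hp : Fintype.card ι < p) (m : ι → ℤ) {M : ℕ} (hm : ∀ i, (m i).natAbs ≤ M) (i₀ i₁ : ι)
    (hne : m i₁ ≠ m i₀) :
    ∃ (v : ι → ℤ) (c : ι), (∀ i, (v i).natAbs ≤ 2 * M) ∧
      (Fintype.card ι : L) * v c ≠ ∑ i, (v i : L) ∧
      ∀ d : ι → L, ∏ i, d i = 1 → ∏ i, d i ^ m i = 1 → ∏ i, d i ^ v i = 1 := by
  obtain ⟨v, hB, hz, ⟨i, hi⟩, himp⟩ := exists_exponents_not_dvd (L := L) p i₀ i₁ (2 * M)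
    (fun i => m i - m i₀)
    (fun i => (Int.natAbs_sub_le _ _).trans (by have := hm i; have := hm i₀; omega))
    (sub_self _) (sub_ne_zero.2 hne)
  have hN : (Fintype.card ι : L) ≠ 0 := by
    rw [Ne, CharP.cast_eq_zero_iff L p]
    exact Nat.not_dvd_of_pos_of_lt (Fintype.card_pos_iff.2 ⟨i₀⟩) hp
  have hc : ∃ c, (Fintype.card ι : L) * v c ≠ ∑ i, (v i : L) := by
    by_contra! h
    have h0 := h i₀
    rw [hz, Int.cast_zero, mul_zero] at h0
    have := h i
    rw [← h0] at this
    exact hi ((mul_eq_zero.1 this).resolve_left hN)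
  obtain ⟨c, hc⟩ := hc
  refine ⟨v, c, hB, hc, fun d h1 h2 => himp d ?_⟩
  have hd : ∀ i, d i ≠ 0 := fun i h => by
    rw [Finset.prod_eq_zero (Finset.mem_univ i) h] at h1
    exact zero_ne_one h1
  simp only [zpow_sub₀ (hd _), Finset.prod_div_distrib, h2, Finset.prod_zpow, h1, one_zpow,
    div_one]

end Exponents

section Torus

variable {n : ℕ} {L : Type*} [Field L]

theorem conj_eq_diagonal_of_mem_torusOf {γ : (Matrix (Fin n) (Fin n) L)ˣ}
    {x : Matrix.SpecialLinearGroup (Fin n) L} (hx : x ∈ torusOf n L γ) :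
    (γ⁻¹).1 * x.1 * γ.1 = Matrix.diagonal fun j => ((γ⁻¹).1 * x.1 * γ.1) j j := by
  obtain ⟨d, hd, hxd⟩ := hx
  have : (γ⁻¹).1 * x.1 * γ.1 = d := by
    rw [hxd]
    simp [mul_assoc]
  rw [this]
  exact hd.diagonal_diag.symm

theorem det_conj_eq_one (γ : (Matrix (Fin n) (Fin n) L)ˣ)
    (x : Matrix.SpecialLinearGroup (Fin n) L) : ((γ⁻¹).1 * x.1 * γ.1).det = 1 := by
  rw [Matrix.det_mul, Matrix.det_mul, mul_right_comm, ← Matrix.det_mul]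
  simp

theorem prod_diag_conj_eq_one {γ : (Matrix (Fin n) (Fin n) L)ˣ}
    {x : Matrix.SpecialLinearGroup (Fin n) L} (hx : x ∈ torusOf n L γ) :
    ∏ j, ((γ⁻¹).1 * x.1 * γ.1) j j = 1 := by
  rw [← Matrix.det_diagonal, ← conj_eq_diagonal_of_mem_torusOf hx, det_conj_eq_one]

theorem charOf_eq_one_of_const {γ : (Matrix (Fin n) (Fin n) L)ˣ}
    {x : Matrix.SpecialLinearGroup (Fin n) L} (hx : x ∈ torusOf n L γ) (m : Fin n → ℤ) (c : ℤ)
    (hm : ∀ i, m i = c) : charOf n L γ m x = 1 := by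
  simp only [charOf, hm]
  rw [Finset.prod_zpow, prod_diag_conj_eq_one hx, one_zpow]

/-- Conjugation of the image of `SL_n(K)` by `γ⁻¹`. -/
def conjMap {K : Type*} [Field K] [Algebra K L] (γ : (Matrix (Fin n) (Fin n) L)ˣ) :
    Matrix.SpecialLinearGroup (Fin n) K →* Matrix.SpecialLinearGroup (Fin n) L where
  toFun x := ⟨(γ⁻¹).1 * (Matrix.SpecialLinearGroup.map (algebraMap K L) x).1 * γ.1,
    det_conj_eq_one γ _⟩
  map_one' := Subtype.ext (by simp)
  map_mul' x y := Subtype.ext (by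
    change _ = ((γ⁻¹).1 * (Matrix.SpecialLinearGroup.map (algebraMap K L) x).1 * γ.1) *
      ((γ⁻¹).1 * (Matrix.SpecialLinearGroup.map (algebraMap K L) y).1 * γ.1)
    simp [mul_assoc])

theorem conjMap_injective {K : Type*} [Field K] [Algebra K L] (γ : (Matrix (Fin n) (Fin n) L)ˣ) :
    Function.Injective (conjMap (K := K) γ) := by
  intro x y h
  have h' : (γ⁻¹).1 * (Matrix.SpecialLinearGroup.map (algebraMap K L) x).1 * γ.1 =
      (γ⁻¹).1 * (Matrix.SpecialLinearGroup.map (algebraMap K L) y).1 * γ.1 :=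
    congrArg Subtype.val h
  rw [Units.mul_left_inj, Units.mul_right_inj] at h'
  ext i j
  exact (algebraMap K L).injective (congrFun (congrFun h' i) j)

end Torus

theorem prodSet_ncard_pos {G : Type*} [Group G] [Finite G] (A : Set G) (r : ℕ) :
    0 < (prodSet A r).ncard := by
  refine (Set.ncard_pos (Set.toFinite _)).2 ⟨1, ?_⟩
  have := Set.pow_mem_pow (n := r) (show (1 : G) ∈ A ∪ A⁻¹ ∪ {1} from Or.inr rfl)
  rwa [one_pow] at this

theorem card_specialLinearGroup_le {n : ℕ} {K : Type*} [Field K] [Fintype K] {D : ℕ}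
    (hD : Fintype.card K ≤ D) (S : Set (Matrix.SpecialLinearGroup (Fin n) K)) :
    S.ncard ≤ D ^ (n * n) := by
  classical
  calc S.ncard ≤ Nat.card (Matrix.SpecialLinearGroup (Fin n) K) := Set.ncard_le_card S
    _ ≤ Nat.card (Matrix (Fin n) (Fin n) K) :=
      Nat.card_le_card_of_injective Subtype.val Subtype.val_injective
    _ = Fintype.card K ^ (n * n) := by
      change Nat.card (Fin n → Fin n → K) = _
      simp [← pow_mul]
    _ ≤ _ := Nat.pow_le_pow_left hD _

theorem le_mul_rpow_of_pow_le {s c w l : ℕ} (hl : 0 < l) (h : s ^ l ≤ c * w) :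
    (s : ℝ) ≤ c * (w : ℝ) ^ ((1 : ℝ) / l) := by
  have hl' : l ≠ 0 := hl.ne'
  have hw : ((w : ℝ) ^ ((1 : ℝ) / l)) ^ l = w := by
    rw [one_div, Real.rpow_inv_natCast_pow (Nat.cast_nonneg _) hl']
  refine le_of_pow_le_pow_left₀ hl' (by positivity) ?_
  rw [mul_pow, hw]
  calc (s : ℝ) ^ l ≤ c * w := by exact_mod_cast h
    _ ≤ c ^ l * w := by
      gcongr
      exact_mod_cast Nat.le_self_pow hl' c

/-- For `n ≥ 2` and a bound `M ≥ 1` there exist `C > 0` and `k ≥ 1` such that for every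
finite field `K` of characteristic `> n`, every maximal torus `T = γ D γ⁻¹` of `SL_n`
over `K̄`, every nontrivial character `α` of `T` with exponents bounded by `M` in absolute
value, and every generating set `A` of `SL_n(K)`, one has
`|A ∩ T'(K)| ≤ C·|A_k|^(1/(n+2))`, where `T' = ker α`. -/
theorem statement_6 (n : ℕ) (hn : 2 ≤ n) (M : ℕ) (hM : 0 < M) :
    ∃ (C : ℝ) (k : ℕ), 0 < C ∧ 0 < k ∧
      ∀ (K : Type) [Field K] [Fintype K], n < ringChar K →
        ∀ (γ : (Matrix (Fin n) (Fin n) (AlgebraicClosure K))ˣ) (m : Fin n → ℤ),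
          (∀ i, (m i).natAbs ≤ M) →
          -- `α` is nontrivial on `T`
          (∃ x ∈ torusOf n (AlgebraicClosure K) γ, charOf n (AlgebraicClosure K) γ m x ≠ 1) →
          ∀ A : Set (Matrix.SpecialLinearGroup (Fin n) K),
            Subgroup.closure A = ⊤ →
            ((A ∩ {x : Matrix.SpecialLinearGroup (Fin n) K |
                Matrix.SpecialLinearGroup.map (algebraMap K (AlgebraicClosure K)) x ∈
                  torusOf n (AlgebraicClosure K) γ ∧
                charOf n (AlgebraicClosure K) γ m
                  (Matrix.SpecialLinearGroup.map (algebraMap K (AlgebraicClosure K)) x) = 1}).ncard : ℝ) ≤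
              C * ((prodSet A k).ncard : ℝ) ^ ((1 : ℝ) / (n + 2)) := by
  let l := n + 2
  let D := (n + 1) * (l * n)
  let r := (n * n + 1) ^ D
  let B := (l * n * (l + n * (2 * M + 1)) + 2) ^ (l * n)
  let C := B * (r + 1) ^ l + (D ^ (n * n)) ^ l + 1
  refine ⟨C, l * (r + 1), by positivity, by positivity, ?_⟩
  intro K _ _ hchar γ m hm hnontriv A hA
  set T : Set (Matrix.SpecialLinearGroup (Fin n) K) := A ∩ _
  have hl : ((n : ℝ) + 2) = ((l : ℕ) : ℝ) := by simp [l]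
  rw [hl]
  refine le_mul_rpow_of_pow_le (by positivity) ?_
  have hpos := prodSet_ncard_pos A (l * (r + 1))
  by_cases hK : Fintype.card K ≤ D
  · calc T.ncard ^ l ≤ (D ^ (n * n)) ^ l := Nat.pow_le_pow_left (card_specialLinearGroup_le hK T) l
      _ ≤ C := by omega
      _ ≤ C * (prodSet A (l * (r + 1))).ncard := Nat.le_mul_of_pos_right _ hpos
  · have : Fact (ringChar K).Prime := ⟨CharP.char_is_prime K _⟩
    have : CharP (AlgebraicClosure K) (ringChar K) :=
      charP_of_injective_algebraMap (algebraMap K (AlgebraicClosure K)).injective _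
    have : Nontrivial (Fin n) := Fin.nontrivial_iff_two_le.2 hn
    obtain ⟨i₀, i₁, hne⟩ : ∃ i₀ i₁, m i₁ ≠ m i₀ := by
      by_contra! h
      obtain ⟨x, hx, hx1⟩ := hnontriv
      exact hx1 (charOf_eq_one_of_const hx m (m ⟨0, by omega⟩) fun i => h _ i)
    obtain ⟨v, c, hv, hc, himp⟩ := exists_exponents_card_mul_ne_sum (L := AlgebraicClosure K)
      (ringChar K) (by simpa using hchar) m hm i₀ i₁ hne
    obtain ⟨X, hXA, hXc, hX⟩ := exists_finset_prodSet_detecting_specialLinearGroup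
      (not_le.1 hK) A hA (conjMap γ) γ fun x => rfl
    rw [Fintype.card_fin] at hXA hXc
    have hN : (Fintype.card (Fin n) : AlgebraicClosure K) ≠ 0 := by
      rw [Ne, CharP.cast_eq_zero_iff (AlgebraicClosure K) (ringChar K), Fintype.card_fin]
      exact Nat.not_dvd_of_pos_of_lt (by omega) hchar
    have hTt : ∀ s ∈ (Set.toFinite T).toFinset, s ∈ T :=
      fun s hs => (Set.Finite.mem_toFinset _).1 hs
    have hcount := card_pow_le_of_detecting (k := n + 1) (M := 2 * M)
      (by rw [Fintype.card_fin]) hN v hv c hc (conjMap γ) (conjMap_injective γ) A X hXA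
      (by rwa [Fintype.card_fin])
      (Set.toFinite T).toFinset (fun s hs => (hTt s hs).1)
      (fun s j => (conjMap (L := AlgebraicClosure K) γ s).1 j j)
      (fun s hs => conj_eq_diagonal_of_mem_torusOf (hTt s hs).2.1)
      (fun s hs => prod_diag_conj_eq_one (hTt s hs).2.1)
      (fun s hs => himp _ (prod_diag_conj_eq_one (hTt s hs).2.1) (hTt s hs).2.2)
      (Set.toFinite (prodSet A (l * (r + 1)))).toFinset
      (fun w hw => (Set.Finite.mem_toFinset _).2 hw)
    rw [← Set.ncard_eq_toFinset_card, ← Set.ncard_eq_toFinset_card, Fintype.card_fin] at hcount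
    calc T.ncard ^ l ≤ B * (X.card ^ l * (prodSet A (l * (r + 1))).ncard) := hcount
      _ ≤ B * ((r + 1) ^ l * (prodSet A (l * (r + 1))).ncard) := by gcongr
      _ = B * (r + 1) ^ l * (prodSet A (l * (r + 1))).ncard := by ring
      _ ≤ C * (prodSet A (l * (r + 1))).ncard := Nat.mul_le_mul_right _ (by omega)
end

section
/- Let n and d be positive integers and let K be an algebraically closed field. Let H be a subgroup of the multiplicative group (K^×)ⁿ (under coordinatewise multiplication) which is contained in the zero set of some nonzero polynomial P ∈ K[x₁,…,x_n] of total degree at most d. Then there exist integers m₁,…,m_n, not all zero, with each |m_i| bounded by a constant depending only on n and d, such that x₁^{m₁}·x₂^{m₂}⋯x_n^{m_n} = 1 for every (x₁,…,x_n) ∈ H. -/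
/-- The restriction of the monomial `∏ i, x i ^ a i` to a subgroup of `(Kˣ)ⁿ`, as a character. -/
def monomialCharacter {K σ : Type*} [Field K] [Fintype σ] (H : Subgroup (σ → Kˣ)) (a : σ →₀ ℕ) :
    H →* K where
  toFun x := ((∏ i, (x : σ → Kˣ) i ^ a i : Kˣ) : K)
  map_one' := by simp
  map_mul' x y := by simp [mul_pow, Finset.prod_mul_distrib]

/-- If a nonzero polynomial vanishes on a subgroup of `(Kˣ)ⁿ`, then two distinct monomials of its
support agree on that subgroup. -/
theorem exists_monomialCharacter_eq {K σ : Type*} [Field K] [Fintype σ] (H : Subgroup (σ → Kˣ))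
    (P : MvPolynomial σ K) (hP : P ≠ 0)
    (hH : ∀ x ∈ H, MvPolynomial.eval (fun i => ((x i : Kˣ) : K)) P = 0) :
    ∃ a ∈ P.support, ∃ b ∈ P.support, a ≠ b ∧
      monomialCharacter H a = monomialCharacter H b := by
  by_contra! hne
  have hinj : Function.Injective fun a : P.support => monomialCharacter H a.1 := fun a b hab =>
    Subtype.ext (by_contra fun h => hne a a.2 b b.2 h hab)
  have hli := (linearIndependent_monoidHom H K).comp _ hinj
  rw [Fintype.linearIndependent_iff] at hli
  obtain ⟨a, ha⟩ := MvPolynomial.support_nonempty.2 hP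
  refine MvPolynomial.mem_support_iff.1 ha (hli (fun a => P.coeff a.1) ?_ ⟨a, ha⟩)
  ext x
  rw [Pi.zero_apply, ← hH x x.2, MvPolynomial.eval_eq', ← Finset.sum_coe_sort P.support]
  simp [Finset.sum_apply, monomialCharacter]


/-- Let `n, d ≥ 1` and let `K` be an algebraically closed field. If a subgroup `H` of
`(K^×)ⁿ` is contained in the zero set of a nonzero polynomial `P` of total degree at most
`d`, then there are integers `m₁,…,m_n`, not all zero and bounded in absolute value by a
constant depending only on `n` and `d`, with `x₁^{m₁}⋯x_n^{m_n} = 1` for all `x ∈ H`. -/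
theorem statement_7 (n d : ℕ) (hn : 0 < n) (hd : 0 < d) :
    ∃ B : ℕ, ∀ (K : Type) [Field K] [IsAlgClosed K],
      ∀ (H : Subgroup (Fin n → Kˣ)) (P : MvPolynomial (Fin n) K),
        P ≠ 0 → P.totalDegree ≤ d →
        (∀ x ∈ H, MvPolynomial.eval (fun i => ((x i : Kˣ) : K)) P = 0) →
        ∃ m : Fin n → ℤ, m ≠ 0 ∧ (∀ i, (m i).natAbs ≤ B) ∧
          ∀ x ∈ H, ∏ i : Fin n, (x i) ^ (m i) = 1 := by
  refine ⟨d, fun K _ _ H P hP hdeg hH => ?_⟩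
  obtain ⟨a, ha, b, hb, hab, h⟩ := exists_monomialCharacter_eq H P hP hH
  have hle : ∀ c ∈ P.support, ∀ i, c i ≤ d := fun c hc i =>
    ((MvPolynomial.monomial_le_degreeOf i hc).trans (P.degreeOf_le_totalDegree i)).trans hdeg
  refine ⟨fun i => (a i : ℤ) - b i, fun h0 => hab ?_, fun i => ?_, fun x hx => ?_⟩
  · ext i
    have := congrFun h0 i
    simp only [Pi.zero_apply] at this
    omega
  · dsimp only
    have := hle a ha i
    have := hle b hb i
    omega
  · have hx' : ∏ i, x i ^ a i = ∏ i, x i ^ b i :=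
      Units.ext (DFunLike.congr_fun h (⟨x, hx⟩ : H) :)
    simp [zpow_sub, Finset.prod_mul_distrib, hx']
end

section
/- Let K be a field, let n be a positive integer, let s₁,…,s_n be distinct elements of K^×, and let i be an integer with 0 ≤ i ≤ n. Then the n × n matrix A_i whose j-th row is (1, s_j, s_j², …, s_j^{i-1}, s_j^{i+1}, …, s_j^n) (i.e., the powers s_j^m for m ∈ {0,1,…,n} \ {i}, in increasing order of m) has determinant equal to (∏_{1 ≤ j < k ≤ n} (s_k − s_j)) · S_{n−i}, where S_{n−i} is the sum of all square-free monomials of degree n−i in s₁,…,s_n. -/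
open Polynomial in
/-- The Vandermonde matrix in `n + 1` columns with column `i` removed has determinant the
Vandermonde product times the elementary symmetric function of degree `n - i`. -/
theorem Matrix.det_pow_succAbove {R : Type*} [CommRing R] {n : ℕ} (s : Fin n → R)
    (i : Fin (n + 1)) :
    Matrix.det (Matrix.of fun j m : Fin n => s j ^ (i.succAbove m : ℕ)) =
      (∏ j : Fin n, ∏ k ∈ Finset.Ioi j, (s k - s j)) *
        ∑ t ∈ Finset.powersetCard (n - i) (Finset.univ : Finset (Fin n)),
          ∏ j ∈ t, s j := by
  have hprod := Matrix.det_vandermonde (Fin.cons (-X) fun j => C (s j) : Fin (n + 1) → R[X])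
  have hminor (l : Fin (n + 1)) :
      ((Matrix.vandermonde (Fin.cons (-X) fun j => C (s j) : Fin (n + 1) → R[X])).submatrix
        Fin.succ l.succAbove).det =
      C (Matrix.det (Matrix.of fun j m : Fin n => s j ^ (l.succAbove m : ℕ))) := by
    rw [RingHom.map_det]
    congr 1
    ext1 j m
    simp [-Matrix.vandermonde_cons]
  rw [Matrix.det_succ_row_zero, Fin.prod_univ_succ] at hprod
  simp only [hminor, Matrix.vandermonde_apply, Fin.cons_zero, ← mul_pow, neg_mul_neg, one_mul,
    Fin.prod_Ioi_zero, Fin.prod_Ioi_succ, Fin.cons_succ, sub_neg_eq_add, ← map_sub,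
    ← map_prod] at hprod
  have hcoeff := congrArg (fun p => p.coeff (i : ℕ)) hprod
  simp only [add_comm (C _) X, coeff_mul_C, finsetSum_coeff, coeff_X_pow, Fin.val_inj,
    ite_mul, one_mul, zero_mul, Finset.sum_ite_eq, Finset.mem_univ, if_true] at hcoeff
  rw [hcoeff, Finset.prod_X_add_C_coeff _ _ (by simpa using i.is_le), mul_comm, Finset.card_fin]

/-- Generalised Vandermonde determinant: for distinct `s₁,…,s_n ∈ K^×` and `0 ≤ i ≤ n`,
the matrix whose `j`-th row is `(s_j^m)` for `m ∈ {0,…,n} \ {i}` (in increasing order of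
`m`) has determinant `(∏_{j<k}(s_k − s_j)) · S_{n−i}`, where `S_{n−i}` is the sum of all
square-free monomials of degree `n−i` in `s₁,…,s_n`. -/
theorem statement_10 (K : Type*) [Field K] (n : ℕ) (hn : 0 < n)
    (s : Fin n → K) (hs : Function.Injective s) (hs0 : ∀ j, s j ≠ 0)
    (i : ℕ) (hi : i ≤ n) :
    Matrix.det (Matrix.of fun j m : Fin n =>
        s j ^ (if (m : ℕ) < i then (m : ℕ) else (m : ℕ) + 1)) =
      (∏ j : Fin n, ∏ k ∈ Finset.Ioi j, (s k - s j)) *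
        ∑ t ∈ Finset.powersetCard (n - i) (Finset.univ : Finset (Fin n)),
          ∏ j ∈ t, s j := by
  rw [← Matrix.det_pow_succAbove s ⟨i, Nat.lt_succ_of_le hi⟩]
  congr 1
  ext j m
  simp only [Matrix.of_apply, Fin.succAbove, Fin.lt_def, Fin.val_castSucc]
  split_ifs <;> rfl
end

section
/- Let K be a field, let n be a positive integer, and let t = diag(s₁,…,s_n) ∈ SL_n(K) be a diagonal matrix whose diagonal entries s₁,…,s_n are pairwise distinct elements of K^×, and suppose that the m-th elementary symmetric polynomial of (s₁,…,s_n) is nonzero for every m with 1 ≤ m ≤ n−1. Then for each i ∈ {0,1,…,n}, the n linear forms g ↦ tr(t^j g), for j ∈ {0,1,…,n} \ {i}, on the space of n × n matrices over K are linearly independent: if scalars c_j ∈ K (j ∈ {0,…,n}, j ≠ i) satisfy Σ_{j ≠ i} c_j·tr(t^j g) = 0 for every n × n matrix g over K, then c_j = 0 for all j. -/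
open Polynomial in
/-- A polynomial of degree at most `n` vanishing at `n` distinct points is a multiple of the
nodal polynomial of these points. -/
theorem Polynomial.eq_C_mul_prod_X_sub_C_of_eval_eq_zero {K : Type*} [Field K] {n : ℕ}
    {s : Fin n → K} (hs : Function.Injective s) {p : K[X]} (hp : p.natDegree ≤ n)
    (heval : ∀ k, p.eval (s k) = 0) :
    p = C (p.coeff n) * ∏ k, (X - C (s k)) := by
  have hmonic : (∏ k, (X - C (s k))).Monic := monic_prod_of_monic _ _ fun k _ => monic_X_sub_C _
  have hdeg : (∏ k, (X - C (s k))).natDegree = n := by simp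
  have hcoeff : (∏ k, (X - C (s k))).coeff n = 1 := by
    have := hmonic.coeff_natDegree
    rwa [hdeg] at this
  rw [← sub_eq_zero]
  refine Polynomial.eq_zero_of_degree_lt_of_eval_index_eq_zero Finset.univ (v := s) hs.injOn ?_ ?_
  · rw [Finset.card_univ, Fintype.card_fin, degree_lt_iff_coeff_zero]
    intro m hm
    rcases hm.eq_or_lt with rfl | hlt
    · rw [coeff_sub, coeff_C_mul, hcoeff, mul_one, sub_self]
    · rw [coeff_sub, coeff_C_mul, coeff_eq_zero_of_natDegree_lt (hp.trans_lt hlt),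
        coeff_eq_zero_of_natDegree_lt (hdeg.trans_lt hlt), mul_zero, sub_zero]
  · intro k _
    rw [eval_sub, eval_mul, heval, eval_prod, Finset.prod_eq_zero (Finset.mem_univ k) (by simp)]
    simp

open Polynomial in
/-- Vieta's formula for the coefficients of `∏ k ∈ u, (X - C (s k))`. -/
theorem Finset.coeff_prod_X_sub_C {R σ : Type*} [CommRing R] (u : Finset σ) (s : σ → R) {k : ℕ}
    (h : k ≤ u.card) :
    (∏ j ∈ u, (X - C (s j))).coeff k =
      (-1) ^ (u.card - k) * ∑ t ∈ u.powersetCard (u.card - k), ∏ j ∈ t, s j := by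
  have := Multiset.prod_X_sub_C_coeff (u.val.map s) (k := k) (by simpa using h)
  rw [Multiset.map_map, Finset.esymm_map_val, Multiset.card_map] at this
  exact this

/-- The trace of a power of a diagonal matrix against a diagonal matrix unit. -/
theorem Matrix.trace_diagonal_pow_mul_single {ι R : Type*} [Fintype ι] [DecidableEq ι]
    [CommSemiring R] (s : ι → R) (m : ℕ) (k : ι) :
    (Matrix.diagonal s ^ m * Matrix.single k k 1).trace = s k ^ m := by
  rw [Matrix.diagonal_pow, Matrix.trace_mul_single]
  simp


/-- Let `t = diag(s₁,…,s_n) ∈ SL_n(K)` with the `s_j` pairwise distinct and nonzero, and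
suppose every elementary symmetric polynomial `e_m(s₁,…,s_n)` with `1 ≤ m ≤ n−1` is
nonzero. Then for each `i ∈ {0,…,n}` the `n` linear forms `g ↦ tr(t^j g)`,
`j ∈ {0,…,n} \ {i}`, are linearly independent. -/
theorem statement_12 (K : Type*) [Field K] (n : ℕ) (hn : 0 < n)
    (s : Fin n → K) (hs : Function.Injective s) (hs0 : ∀ j, s j ≠ 0)
    (hdet : ∏ j : Fin n, s j = 1)
    (hesymm : ∀ m : ℕ, 1 ≤ m → m ≤ n - 1 →
      ∑ t ∈ Finset.powersetCard m (Finset.univ : Finset (Fin n)), ∏ j ∈ t, s j ≠ 0)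
    (i : Fin (n + 1)) (c : Fin (n + 1) → K) (hci : c i = 0)
    (hlin : ∀ g : Matrix (Fin n) (Fin n) K,
      ∑ j : Fin (n + 1), c j * ((Matrix.diagonal s ^ (j : ℕ)) * g).trace = 0) :
    ∀ j, c j = 0 := by
  set p : Polynomial K := ∑ j : Fin (n + 1), Polynomial.C (c j) * Polynomial.X ^ (j : ℕ) with hp
  have hcoeff : ∀ j : Fin (n + 1), p.coeff j = c j := fun j => by
    simp [hp, Polynomial.finsetSum_coeff, Polynomial.coeff_C_mul, Polynomial.coeff_X_pow,
      Fin.val_inj]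
  have hdeg : p.natDegree ≤ n :=
    Polynomial.natDegree_sum_le_of_forall_le _ _ fun j _ =>
      (Polynomial.natDegree_C_mul_X_pow_le _ _).trans (Nat.lt_succ_iff.mp j.isLt)
  have heval : ∀ k, p.eval (s k) = 0 := fun k => by
    simpa [hp, Polynomial.eval_finsetSum, Matrix.trace_diagonal_pow_mul_single]
      using hlin (Matrix.single k k 1)
  have hmul := Polynomial.eq_C_mul_prod_X_sub_C_of_eval_eq_zero hs hdeg heval
  have hesymm' : ∑ t ∈ Finset.powersetCard (n - i) (Finset.univ : Finset (Fin n)),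
      ∏ j ∈ t, s j ≠ 0 := by
    rcases Nat.eq_zero_or_pos (n - i) with h0 | hpos
    · simp [h0]
    · rcases Nat.eq_zero_or_pos (i : ℕ) with hi | hi
      · have hself := Finset.powersetCard_self (Finset.univ : Finset (Fin n))
        rw [Finset.card_univ, Fintype.card_fin] at hself
        rw [hi, Nat.sub_zero, hself, Finset.sum_singleton, hdet]
        exact one_ne_zero
      · exact hesymm _ hpos (by omega)
  have hi := hcoeff i
  have hin : (i : ℕ) ≤ (Finset.univ : Finset (Fin n)).card := by
    simpa using Nat.lt_succ_iff.mp i.isLt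
  rw [hci, hmul, Polynomial.coeff_C_mul, Finset.coeff_prod_X_sub_C _ _ hin, Finset.card_univ,
    Fintype.card_fin] at hi
  have hlead : p.coeff n = 0 :=
    (mul_eq_zero.mp hi).resolve_right (mul_ne_zero (pow_ne_zero _ (by simp)) hesymm')
  intro j
  rw [← hcoeff j, hmul, hlead]
  simp
end

section
/- Let R be a commutative ring (e.g., a field), let n be a positive integer, and let t₁,…,t_n ∈ R. For 1 ≤ k ≤ n−1 and 1 ≤ i ≤ n, let c_{k,i} be the sum of all monomials t_{j₁}t_{j₂}⋯t_{j_k} over k-element subsets {j₁ < j₂ < ⋯ < j_k} of {1,…,n} such that one of the indices j_l equals i, and set c_{0,i} = 1 for all i. Then the determinant of the n × n matrix (c_{i−1,j})_{1 ≤ i,j ≤ n} equals, up to a sign depending only on n, the Vandermonde product: det(c_{i−1,j})_{1 ≤ i,j ≤ n} = (−1)^{(n−1)(n−2)/2} · ∏_{1 ≤ j₁ < j₂ ≤ n} (t_{j₂} − t_{j₁}). In particular, this determinant is nonzero if and only if the Vandermonde determinant det(t_j^{i−1})_{1 ≤ i,j ≤ n} is nonzero. -/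
/-- The matrix `(c_{i−1,j})` (0-based: row `i`, column `j`, entry `c_{i,j}` with
`c_{0,j} = 1`), where `c_{k,j}` is the sum of all monomials `t_{j₁}⋯t_{j_k}` over
`k`-element subsets of `{1,…,n}` containing `j`. -/
def cMatrix (R : Type*) [CommRing R] (n : ℕ) (t : Fin n → R) : Matrix (Fin n) (Fin n) R :=
  Matrix.of fun i j =>
    if (i : ℕ) = 0 then 1
    else ∑ T ∈ (Finset.powersetCard (i : ℕ) (Finset.univ : Finset (Fin n))).filter
        (fun T => j ∈ T), ∏ l ∈ T, t l

open Finset in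
/-- Monomials containing `t j` arise by multiplying `t j` into those that do not. -/
lemma sum_powersetCard_succ_filter_mem {R ι : Type*} [CommRing R] [Fintype ι] [DecidableEq ι]
    (t : ι → R) (j : ι) (k : ℕ) :
    ∑ T ∈ (powersetCard (k + 1) univ).filter (fun T => j ∈ T), ∏ l ∈ T, t l =
      t j * (∑ T ∈ powersetCard k univ, ∏ l ∈ T, t l -
        ∑ T ∈ (powersetCard k univ).filter (fun T => j ∈ T), ∏ l ∈ T, t l) := by
  rw [← sum_filter_add_sum_filter_not (powersetCard k univ) (fun T => j ∈ T), add_sub_cancel_left,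
    mul_sum]
  refine sum_bij' (fun T _ => T.erase j) (fun T _ => insert j T) ?_ ?_ ?_ ?_ ?_
  · intro T hT
    simp only [mem_filter, mem_powersetCard_univ] at hT ⊢
    simp [card_erase_of_mem hT.2, hT.1]
  · intro T hT
    simp only [mem_filter, mem_powersetCard_univ] at hT ⊢
    simp [card_insert_of_notMem hT.2, hT.1]
  · intro T hT
    exact insert_erase (mem_filter.1 hT).2
  · intro T hT
    exact erase_insert (mem_filter.1 hT).2
  · intro T hT
    exact (mul_prod_erase T t (mem_filter.1 hT).2).symm

/-- The monic polynomial of degree `k` whose value at `t j` is `c_{k,j}` up to sign. -/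
noncomputable def cPolynomial {R ι : Type*} [CommRing R] [Fintype ι] (t : ι → R) :
    ℕ → Polynomial R
  | 0 => 1
  | 1 => Polynomial.X
  | k + 2 => (cPolynomial t (k + 1) + Polynomial.C ((-1) ^ (k + 1) *
      ∑ T ∈ Finset.powersetCard (k + 1) Finset.univ, ∏ l ∈ T, t l)) * Polynomial.X

lemma cPolynomial_monic_and_natDegree {R ι : Type*} [CommRing R] [Nontrivial R] [Fintype ι]
    (t : ι → R) (k : ℕ) : (cPolynomial t k).Monic ∧ (cPolynomial t k).natDegree = k := by
  induction k using cPolynomial.induct with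
  | case1 => simp [cPolynomial]
  | case2 => simp [cPolynomial, Polynomial.monic_X]
  | case3 k ih =>
    obtain ⟨hm, hd⟩ := ih
    have hm' : (cPolynomial t (k + 1) + Polynomial.C ((-1) ^ (k + 1) *
        ∑ T ∈ Finset.powersetCard (k + 1) Finset.univ, ∏ l ∈ T, t l)).Monic := by
      refine hm.add_of_left (Polynomial.degree_C_le.trans_lt ?_)
      rw [Polynomial.degree_eq_natDegree hm.ne_zero, hd]
      exact_mod_cast k.succ_pos
    rw [cPolynomial]
    exact ⟨hm'.mul Polynomial.monic_X, by
      rw [Polynomial.natDegree_mul_X hm'.ne_zero, Polynomial.natDegree_add_C, hd]⟩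

lemma sum_filter_mem_eq_eval_cPolynomial {R ι : Type*} [CommRing R] [Fintype ι] [DecidableEq ι]
    (t : ι → R) (j : ι) (k : ℕ) :
    ∑ T ∈ (Finset.powersetCard (k + 1) Finset.univ).filter (fun T => j ∈ T), ∏ l ∈ T, t l =
      (-1) ^ k * (cPolynomial t (k + 1)).eval (t j) := by
  induction k with
  | zero =>
    rw [sum_powersetCard_succ_filter_mem]
    simp [cPolynomial, Finset.filter_singleton]
  | succ k ih =>
    have hsq : ((-1 : R) ^ k) * (-1) ^ k = 1 := by rw [← mul_pow]; simp
    rw [sum_powersetCard_succ_filter_mem, ih, cPolynomial]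
    simp only [Polynomial.eval_mul, Polynomial.eval_add, Polynomial.eval_C, Polynomial.eval_X,
      pow_succ]
    linear_combination (-(t j) *
      ∑ T ∈ Finset.powersetCard (k + 1) Finset.univ, ∏ l ∈ T, t l) * hsq

lemma prod_neg_one_pow_pred (R : Type*) [CommRing R] (n : ℕ) :
    ∏ i : Fin n, (-1 : R) ^ ((i : ℕ) - 1) = (-1) ^ ((n - 1) * (n - 2) / 2) := by
  rw [Finset.prod_pow_eq_pow_sum, Fin.sum_univ_eq_sum_range (fun i => i - 1)]
  cases n with
  | zero => simp
  | succ m => simp [Finset.sum_range_succ', Finset.sum_range_id]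

lemma det_cMatrix (R : Type*) [CommRing R] (n : ℕ) (t : Fin n → R) :
    (cMatrix R n t).det =
      (-1) ^ ((n - 1) * (n - 2) / 2) * (Matrix.vandermonde t).det := by
  nontriviality R
  rw [← prod_neg_one_pow_pred, Matrix.det_eval_matrixOfPolynomials_eq_det_vandermonde t
    (fun i => cPolynomial t i) (fun i => (cPolynomial_monic_and_natDegree t i).2)
    (fun i => (cPolynomial_monic_and_natDegree t i).1), ← Matrix.det_transpose (Matrix.of _),
    ← Matrix.det_mul_column]
  congr 1
  ext i j
  rcases i with ⟨_ | k, hk⟩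
  · simp [cMatrix, cPolynomial]
  · simp [cMatrix, sum_filter_mem_eq_eval_cPolynomial]

/-- `det(c_{i−1,j}) = (−1)^{(n−1)(n−2)/2} · ∏_{j₁<j₂}(t_{j₂} − t_{j₁})`; in particular
this determinant is nonzero iff the Vandermonde determinant `det(t_j^{i−1})` is. -/
theorem statement_13 (R : Type*) [CommRing R] (n : ℕ) (hn : 0 < n) (t : Fin n → R) :
    (cMatrix R n t).det =
      (-1) ^ ((n - 1) * (n - 2) / 2) *
        ∏ j₁ : Fin n, ∏ j₂ ∈ Finset.Ioi j₁, (t j₂ - t j₁) ∧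
    ((cMatrix R n t).det ≠ 0 ↔
      (Matrix.of fun i j : Fin n => t j ^ (i : ℕ)).det ≠ 0) := by
  have hV : (Matrix.of fun i j : Fin n => t j ^ (i : ℕ)).det = (Matrix.vandermonde t).det :=
    Matrix.det_transpose (Matrix.vandermonde t)
  rw [hV, det_cMatrix, Matrix.det_vandermonde]
  exact ⟨rfl, ((isUnit_one.neg.pow _).mul_right_eq_zero).not⟩
end
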